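/- Let m be a positive integer and let H = F_{[−m;m]∖{0}}(x,u) be the face generating function of the m-extended semiorder arrangements. Then, writing X = e^x − 1, H satisfies the identity (H − 1 − (1 − e^{−xu})·H^{m+1}) · (1 − H − X·H + X·H^{m+1}) = u·X²·(H^{m+2} − H^{2m+2}) in ℚ[u][[x]]; equivalently, H = 1 + (1 − e^{−xu})·H^{m+1} + u·Ω̃(e^x − 1, H), where Ω̃(X,Y) = X²·(Y^{m+2} − Y^{2m+2})/(1 − Y − XY + XY^{m+1}), and this equation characterizes H. -/

import Mathlib

open scoped BigOperators Classical

namespace Braid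

def hyp (n : ℕ) (i j : Fin n) (s : ℝ) : Set (Fin n → ℝ) := {x | x i - x j = s}
def arrS (S : Set ℤ) (n : ℕ) : Set (Set (Fin n → ℝ)) :=
  {H | ∃ i j : Fin n, ∃ s : ℤ, i < j ∧ s ∈ S ∧ H = hyp n i j (s : ℝ)}
def IsSideOf (n : ℕ) (σ H : Set (Fin n → ℝ)) : Prop :=
  σ = H ∨ ∃ (i j : Fin n) (s : ℝ), H = hyp n i j s ∧
    (σ = {x | x i - x j < s} ∨ σ = {x | s < x i - x j})
def IsFace (n : ℕ) (A : Set (Set (Fin n → ℝ))) (F : Set (Fin n → ℝ)) : Prop :=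
  F.Nonempty ∧ ∃ σ : Set (Fin n → ℝ) → Set (Fin n → ℝ),
    (∀ H ∈ A, IsSideOf n (σ H) H) ∧ F = ⋂ H ∈ A, σ H
noncomputable def faceDim (n : ℕ) (F : Set (Fin n → ℝ)) : ℕ :=
  Module.finrank ℝ (affineSpan ℝ F).direction

/-- The number `c_{n,k}` of `k`-dimensional faces of `A_S^n`. -/
noncomputable def faceCount (S : Set ℤ) (n k : ℕ) : ℕ :=
  Nat.card {F : Set (Fin n → ℝ) // IsFace n (arrS S n) F ∧ faceDim n F = k}

/-- The face generating function `F_S(x,u) ∈ ℚ[u][[x]]`. -/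
noncomputable def FGF (S : Set ℤ) : PowerSeries (Polynomial ℚ) :=
  PowerSeries.mk fun n => Polynomial.C ((n.factorial : ℚ)⁻¹) *
    ∑ k ∈ Finset.range (n + 1), (faceCount S n k : ℚ) • Polynomial.X ^ k

/-- `e^x` in `ℚ[u][[x]]`. -/
noncomputable def Eexp : PowerSeries (Polynomial ℚ) :=
  PowerSeries.mk fun n => Polynomial.C ((n.factorial : ℚ)⁻¹)

/-- `e^{-x}` in `ℚ[u][[x]]`. -/
noncomputable def EexpNeg : PowerSeries (Polynomial ℚ) :=
  PowerSeries.mk fun n => Polynomial.C ((-1 : ℚ) ^ n * (n.factorial : ℚ)⁻¹)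

/-- The variable `u` as an element of `ℚ[u][[x]]`. -/
noncomputable def Useries : PowerSeries (Polynomial ℚ) := PowerSeries.C Polynomial.X

/-- `e^{xu}` in `ℚ[u][[x]]`. -/
noncomputable def Eexu : PowerSeries (Polynomial ℚ) :=
  PowerSeries.mk fun n => ((n.factorial : ℚ)⁻¹) • Polynomial.X ^ n

/-- `e^{-xu}` in `ℚ[u][[x]]`. -/
noncomputable def EexuNeg : PowerSeries (Polynomial ℚ) :=
  PowerSeries.mk fun n => ((-1 : ℚ) ^ n * (n.factorial : ℚ)⁻¹) • Polynomial.X ^ n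

/-- `Ω̃(e^x - 1, Y)` where `Ω̃(X,Y) = X²(Y^{m+2} - Y^{2m+2})/(1 - Y - XY + XY^{m+1})`,
written via the factorization
`Ω̃(X,Y) = X² Y^{m+2} (1 + Y + ⋯ + Y^{m-1}) · (1 - X(Y + ⋯ + Y^m))⁻¹`. -/
noncomputable def OmTilde (m : ℕ) (Y : PowerSeries (Polynomial ℚ)) :
    PowerSeries (Polynomial ℚ) :=
  (Eexp - 1) ^ 2 * Y ^ (m + 2) * (∑ p ∈ Finset.range m, Y ^ p) *
    PowerSeries.invOfUnit (1 - (Eexp - 1) * ∑ p ∈ Finset.range m, Y ^ (p + 1)) 1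


section Cnt
variable {α β R : Type*} [CommRing R]

/-- Weighted count of the classes of `r` meeting `D`. -/
noncomputable def cnt (r : Setoid α) (w : α → R) (D : Set α) : R :=
  ∑ᶠ c : Quotient r, if c ∈ (Quotient.mk r '' D) then w c.out else 0

lemma mem_mk_image (r : Setoid α) (D : Set α) (x : α) :
    (Quotient.mk r x ∈ Quotient.mk r '' D) ↔ ∃ y ∈ D, r x y := by
  constructor
  · rintro ⟨y, hy, h⟩
    exact ⟨y, hy, r.symm (Quotient.exact h)⟩
  · rintro ⟨y, hy, h⟩
    exact ⟨y, hy, Quotient.sound (r.symm h)⟩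

/-- Indicator of a proposition. -/
noncomputable def ind (p : Prop) (c : R) : R := if p then c else 0

lemma ind_pos {p : Prop} {c : R} (h : p) : ind p c = c := if_pos h
lemma ind_neg {p : Prop} {c : R} (h : ¬ p) : ind p c = 0 := if_neg h

lemma cnt_ie {I : Type*} (r : Setoid α) [Finite (Quotient r)] (w : α → R)
    (s : Finset I) (c : I → R) (D : Set α) (De : I → Set α)
    (h1 : ∀ e ∈ s, ∀ y ∈ De e, ∃ x ∈ D, r x y)
    (h2 : ∀ x ∈ D, ∑ e ∈ s, ind (∃ y ∈ De e, r x y) (c e) = 1) :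
    cnt r w D = ∑ e ∈ s, c e * cnt r w (De e) := by
  have := Fintype.ofFinite (Quotient r)
  unfold cnt
  simp only [finsum_eq_sum_of_fintype, Finset.mul_sum]
  rw [Finset.sum_comm]
  refine Finset.sum_congr rfl fun q _ => ?_
  by_cases hq : q ∈ Quotient.mk r '' D
  · rw [if_pos hq]
    obtain ⟨x, hx, rfl⟩ := hq
    conv_lhs => rw [← one_mul (w _), ← h2 x hx, Finset.sum_mul]
    refine Finset.sum_congr rfl fun e _ => ?_
    simp only [mem_mk_image, ind]
    split_ifs <;> simp
  · rw [if_neg hq, Finset.sum_eq_zero]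
    intro e he
    rw [if_neg, mul_zero]
    rintro ⟨y, hy, rfl⟩
    obtain ⟨x, hx, hxy⟩ := h1 e he y hy
    exact hq ⟨x, hx, Quotient.sound hxy⟩

lemma cnt_transport (r : Setoid α) (r' : Setoid β) [Finite (Quotient r)] [Finite (Quotient r')]
    (w : α → R) (w' : β → R) (hw : ∀ x y, r x y → w x = w y) (hw' : ∀ x y, r' x y → w' x = w' y)
    (D : Set α) (D' : Set β) (f : β → α) (k : R)
    (h1 : ∀ y ∈ D', ∃ x ∈ D, r x (f y))
    (h2 : ∀ y ∈ D', ∀ z ∈ D', r' y z ↔ r (f y) (f z))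
    (h3 : ∀ x ∈ D, ∃ y ∈ D', r x (f y))
    (h4 : ∀ y ∈ D', w (f y) = k * w' y) :
    cnt r w D = k * cnt r' w' D' := by
  have := Fintype.ofFinite (Quotient r)
  have := Fintype.ofFinite (Quotient r')
  have hout : ∀ x, w (Quotient.mk r x).out = w x := fun x =>
    hw _ _ (Quotient.exact (Quotient.out_eq _))
  have hout' : ∀ x, w' (Quotient.mk r' x).out = w' x := fun x =>
    hw' _ _ (Quotient.exact (Quotient.out_eq _))
  unfold cnt
  simp only [finsum_eq_sum_of_fintype, Finset.mul_sum]
  rw [← Finset.sum_filter]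
  simp only [mul_ite, mul_zero]
  rw [← Finset.sum_filter]
  symm
  have ex : ∀ q ∈ Finset.univ.filter (fun q => q ∈ Quotient.mk r' '' D'),
      ∃ y ∈ D', Quotient.mk r' y = q := by
    intro q hq
    exact (Finset.mem_filter.1 hq).2
  choose g hg1 hg2 using ex
  refine Finset.sum_bij (fun q hq => Quotient.mk r (f (g q hq))) ?_ ?_ ?_ ?_
  · intro q hq
    obtain ⟨x, hx, hxy⟩ := h1 _ (hg1 q hq)
    exact Finset.mem_filter.2 ⟨Finset.mem_univ _, ⟨x, hx, Quotient.sound hxy⟩⟩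
  · intro q hq p hp h
    rw [← hg2 q hq, ← hg2 p hp]
    exact Quotient.sound ((h2 _ (hg1 q hq) _ (hg1 p hp)).2 (Quotient.exact h))
  · intro q hq
    obtain ⟨x, hx, rfl⟩ := (Finset.mem_filter.1 hq).2
    obtain ⟨y, hy, hxy⟩ := h3 x hx
    have hm : Quotient.mk r' y ∈ Finset.univ.filter (fun q => q ∈ Quotient.mk r' '' D') :=
      Finset.mem_filter.2 ⟨Finset.mem_univ _, ⟨y, hy, rfl⟩⟩
    refine ⟨Quotient.mk r' y, hm, ?_⟩
    refine Quotient.sound ?_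
    refine r.trans ?_ (r.symm hxy)
    exact (h2 _ (hg1 _ hm) _ hy).1 (Quotient.exact (hg2 _ hm))
  · intro q hq
    rw [hout, h4 _ (hg1 q hq), ← hout' (g q hq), hg2 q hq]
end Cnt

section Geo
variable {ι : Type*} [Fintype ι] [DecidableEq ι]

/-- The relation: same position with respect to the semiorder hyperplanes on the labels `A`,
and with respect to the marks `K`. -/
def SRel (m : ℕ) (A : Finset ι) (K : Finset ℝ) (x y : ι → ℝ) : Prop :=
  (∀ i ∈ A, ∀ j ∈ A, ∀ s : ℕ, 1 ≤ s → s ≤ m →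
    ((x i < x j + s ↔ y i < y j + s) ∧ (x j + s < x i ↔ y j + s < y i))) ∧
  ∀ i ∈ A, ∀ μ ∈ K, ((x i < μ ↔ y i < μ) ∧ (μ < x i ↔ μ < y i))

lemma SRel.refl {m : ℕ} {A : Finset ι} {K : Finset ℝ} (x : ι → ℝ) : SRel m A K x x :=
  ⟨fun _ _ _ _ _ _ _ => ⟨Iff.rfl, Iff.rfl⟩, fun _ _ _ _ => ⟨Iff.rfl, Iff.rfl⟩⟩

lemma SRel.symm {m : ℕ} {A : Finset ι} {K : Finset ℝ} {x y : ι → ℝ} (h : SRel m A K x y) :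
    SRel m A K y x :=
  ⟨fun i hi j hj s h1 h2 => ⟨(h.1 i hi j hj s h1 h2).1.symm, (h.1 i hi j hj s h1 h2).2.symm⟩,
    fun i hi k hk => ⟨(h.2 i hi k hk).1.symm, (h.2 i hi k hk).2.symm⟩⟩

lemma SRel.trans {m : ℕ} {A : Finset ι} {K : Finset ℝ} {x y z : ι → ℝ} (h : SRel m A K x y)
    (h' : SRel m A K y z) : SRel m A K x z :=
  ⟨fun i hi j hj s h1 h2 => ⟨(h.1 i hi j hj s h1 h2).1.trans (h'.1 i hi j hj s h1 h2).1,
      (h.1 i hi j hj s h1 h2).2.trans (h'.1 i hi j hj s h1 h2).2⟩,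
    fun i hi k hk => ⟨(h.2 i hi k hk).1.trans (h'.2 i hi k hk).1,
      (h.2 i hi k hk).2.trans (h'.2 i hi k hk).2⟩⟩

lemma SRel.eq_iff {m : ℕ} {A : Finset ι} {K : Finset ℝ} {x y : ι → ℝ} (h : SRel m A K x y)
    {i j : ι} (hi : i ∈ A) (hj : j ∈ A) {s : ℕ} (h1 : 1 ≤ s) (h2 : s ≤ m) :
    x i = x j + s ↔ y i = y j + s := by
  obtain ⟨a, b⟩ := h.1 i hi j hj s h1 h2
  constructor
  · intro e
    exact le_antisymm (not_lt.1 fun h => absurd (b.2 h) (by simp [e]))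
      (not_lt.1 fun h => absurd (a.2 h) (by simp [e]))
  · intro e
    exact le_antisymm (not_lt.1 fun h => absurd (b.1 h) (by simp [e]))
      (not_lt.1 fun h => absurd (a.1 h) (by simp [e]))

lemma SRel.mark_iff {m : ℕ} {A : Finset ι} {K : Finset ℝ} {x y : ι → ℝ} (h : SRel m A K x y)
    {i : ι} (hi : i ∈ A) {μ : ℝ} (hμ : μ ∈ K) : x i = μ ↔ y i = μ := by
  obtain ⟨a, b⟩ := h.2 i hi μ hμ
  constructor
  · intro e
    exact le_antisymm (not_lt.1 fun h => absurd (b.2 h) (by simp [e]))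
      (not_lt.1 fun h => absurd (a.2 h) (by simp [e]))
  · intro e
    exact le_antisymm (not_lt.1 fun h => absurd (b.1 h) (by simp [e]))
      (not_lt.1 fun h => absurd (a.1 h) (by simp [e]))

/-- `SRel` as a setoid. -/
def sSet (m : ℕ) (A : Finset ι) (K : Finset ℝ) : Setoid (ι → ℝ) where
  r := SRel m A K
  iseqv := ⟨SRel.refl, SRel.symm, SRel.trans⟩

instance sSet_finite (m : ℕ) (A : Finset ι) (K : Finset ℝ) : Finite (Quotient (sSet m A K)) := by
  let sig : (ι → ℝ) → ((ι × ι × Fin (m + 1) → Prop × Prop) × (ι × K → Prop × Prop)) := fun x =>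
    (fun p => (x p.1 < x p.2.1 + ((p.2.2 : ℕ) : ℝ), x p.2.1 + ((p.2.2 : ℕ) : ℝ) < x p.1),
     fun p => (x p.1 < p.2, (p.2 : ℝ) < x p.1))
  have key : ∀ x y, sig x = sig y → SRel m A K x y := by
    intro x y h
    constructor
    · intro i _ j _ s _ hs
      have := congrFun (congrArg Prod.fst h) (i, j, ⟨s, by omega⟩)
      simp only [sig, Prod.mk.injEq, eq_iff_iff] at this
      exact this
    · intro i _ μ hμ
      have := congrFun (congrArg Prod.snd h) (i, ⟨μ, hμ⟩)
      simp only [sig, Prod.mk.injEq, eq_iff_iff] at this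
      exact this
  refine Finite.of_surjective
    (fun p : Set.range sig => (Quotient.mk (sSet m A K) p.2.choose)) ?_
  intro q
  induction q using Quotient.inductionOn with
  | h x =>
    refine ⟨⟨sig x, x, rfl⟩, ?_⟩
    exact Quotient.sound (key _ _ (Exists.choose_spec (⟨x, rfl⟩ : ∃ y, sig y = sig x)))

/-- The linear space of infinitesimal deformations. -/
def VS (m : ℕ) (A : Finset ι) (L : Finset ℝ) (x : ι → ℝ) : Submodule ℝ (ι → ℝ) where
  carrier := {g | (∀ i, i ∉ A → g i = 0) ∧
    (∀ i ∈ A, ∀ j ∈ A, ∀ s : ℕ, 1 ≤ s → s ≤ m → x i = x j + s → g i = g j) ∧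
    ∀ i ∈ A, x i ∈ L → g i = 0}
  add_mem' := by
    rintro a b ⟨h1, h2, h3⟩ ⟨h1', h2', h3'⟩
    refine ⟨fun i hi => ?_, fun i hi j hj s hs hs' e => ?_, fun i hi e => ?_⟩
    · simp [h1 i hi, h1' i hi]
    · simp [h2 i hi j hj s hs hs' e, h2' i hi j hj s hs hs' e]
    · simp [h3 i hi e, h3' i hi e]
  zero_mem' := ⟨fun _ _ => rfl, fun _ _ _ _ _ _ _ _ => rfl, fun _ _ _ => rfl⟩
  smul_mem' := by
    rintro c a ⟨h1, h2, h3⟩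
    refine ⟨fun i hi => ?_, fun i hi j hj s hs hs' e => ?_, fun i hi e => ?_⟩
    · simp [h1 i hi]
    · simp [h2 i hi j hj s hs hs' e]
    · simp [h3 i hi e]

lemma mem_VS {m : ℕ} {A : Finset ι} {L : Finset ℝ} {x g : ι → ℝ} : g ∈ VS m A L x ↔
    (∀ i, i ∉ A → g i = 0) ∧
    (∀ i ∈ A, ∀ j ∈ A, ∀ s : ℕ, 1 ≤ s → s ≤ m → x i = x j + s → g i = g j) ∧
    ∀ i ∈ A, x i ∈ L → g i = 0 := Iff.rfl

lemma VS_congr {m : ℕ} {A : Finset ι} {K L : Finset ℝ} {x y : ι → ℝ} (h : SRel m A K x y)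
    (hL : L ⊆ K) : VS m A L x = VS m A L y := by
  have key : ∀ i ∈ A, (x i ∈ L ↔ y i ∈ L) := by
    intro i hi
    constructor
    · intro hx
      rwa [(h.mark_iff hi (hL hx)).1 rfl]
    · intro hx
      rwa [(h.mark_iff hi (hL hx)).2 rfl]
  ext g
  rw [mem_VS, mem_VS]
  refine and_congr Iff.rfl (and_congr ?_ ?_)
  · refine forall₂_congr fun i hi => forall₂_congr fun j hj => forall_congr' fun s =>
      forall₂_congr fun h1 h2 => ?_
    rw [h.eq_iff hi hj h1 h2]
  · refine forall₂_congr fun i hi => ?_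
    rw [key i hi]

/-- The weight of a configuration. -/
noncomputable def wt (m : ℕ) (A : Finset ι) (L : Finset ℝ) (x : ι → ℝ) : Polynomial ℚ :=
  Polynomial.X ^ (Module.finrank ℝ (VS m A L x))

lemma wt_congr {m : ℕ} {A : Finset ι} {K L : Finset ℝ} (hL : L ⊆ K) (x y : ι → ℝ)
    (h : sSet m A K x y) : wt m A L x = wt m A L y := by
  unfold wt
  rw [VS_congr h hL]

/-- Admissible configurations. -/
def Dom (A : Finset ι) (t : ℝ) (M : Finset ℝ) : Set (ι → ℝ) :=
  {x | ∀ i ∈ A, t < x i ∧ x i ∉ M}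

/-- The weighted count of classes. -/
noncomputable def NN (m : ℕ) (A : Finset ι) (t : ℝ) (M L : Finset ℝ) : Polynomial ℚ :=
  cnt (sSet m A (M ∪ L)) (wt m A L) (Dom A t M)

/-- The segment `{a+1, ..., a+h}`. -/
noncomputable def seg (a : ℝ) (h : ℕ) : Finset ℝ :=
  (Finset.Icc 1 h).image (fun k : ℕ => a + (k : ℝ))

lemma mem_seg {a : ℝ} {h : ℕ} {μ : ℝ} : μ ∈ seg a h ↔ ∃ k : ℕ, 1 ≤ k ∧ k ≤ h ∧ μ = a + k := by
  simp only [seg, Finset.mem_image, Finset.mem_Icc]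
  constructor
  · rintro ⟨k, ⟨h1, h2⟩, rfl⟩
    exact ⟨k, h1, h2, rfl⟩
  · rintro ⟨k, h1, h2, rfl⟩
    exact ⟨k, ⟨h1, h2⟩, rfl⟩

lemma card_seg (a : ℝ) (h : ℕ) : (seg a h).card = h := by
  unfold seg
  rw [Finset.card_image_of_injective]
  · simp
  · intro k l hkl
    simpa using hkl

/-- The invariant of the set of marks. -/
def Inv (t : ℝ) (M : Finset ℝ) : Prop := ∀ μ ∈ M, t < μ ∧ (μ ≤ t + 1 ∨ μ - 1 ∈ M)

/-- The invariant of an open chain. -/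
def JJ (t : ℝ) (M : Finset ℝ) (a : ℝ) : Prop :=
  Inv t M ∧ t ≤ a ∧ (∀ k : ℕ, a - k ∈ M ∨ a - k ≤ t) ∧ ∀ k : ℕ, 1 ≤ k → a + k ∉ M

end Geo

section Geo2
variable {ι : Type*} [Fintype ι] [DecidableEq ι]

/-- Periodic rescaling. -/
lemma exists_psi (α β T : ℝ) (h1 : 0 < α) (h2 : α < T) (h3 : 0 < β) (h4 : β < T) :
    ∃ ψ : ℝ → ℝ, StrictMono ψ ∧ ψ 0 = 0 ∧ ψ α = β ∧ ∀ f, T ≤ f → ψ f = f := by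
  have a1 : 0 < T - α := by linarith
  have a2 : 0 < T - β := by linarith
  refine ⟨fun f => min (max (f * (β / α)) 0 + min f 0) β + max (min (f - α) (T - α)) 0 * ((T - β) / (T - α)) + max (f - T) 0, ?_, ?_, ?_, ?_⟩
  · have p1 : 0 < β / α := by positivity
    have p2 : 0 < (T - β) / (T - α) := by positivity
    have e1 : α * (β / α) = β := by field_simp
    intro x y hxy
    have m1 : min (max (x * (β / α)) 0 + min x 0) β ≤ min (max (y * (β / α)) 0 + min y 0) β := by
      gcongr
    have m2 : max (min (x - α) (T - α)) 0 ≤ max (min (y - α) (T - α)) 0 := by gcongr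
    have m2' := mul_le_mul_of_nonneg_right m2 p2.le
    have m3 : max (x - T) 0 ≤ max (y - T) 0 := by gcongr
    dsimp only
    rcases lt_or_ge x α with hx | hx
    · have : min (max (x * (β / α)) 0 + min x 0) β < min (max (y * (β / α)) 0 + min y 0) β := by
        have hx1 : max (x * (β / α)) 0 + min x 0 < β := by
          rcases le_total x 0 with h | h
          · rw [max_eq_right (by nlinarith), min_eq_left h]; linarith
          · rw [max_eq_left (by positivity), min_eq_right h]; nlinarith
        have hx2 : max (x * (β / α)) 0 + min x 0 < max (y * (β / α)) 0 + min y 0 := by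
          rcases le_total x 0 with h | h
          · rw [max_eq_right (by nlinarith), min_eq_left h]
            rcases le_total y 0 with h' | h'
            · rw [max_eq_right (by nlinarith), min_eq_left h']; linarith
            · rw [max_eq_left (by positivity), min_eq_right h']
              rcases h.lt_or_eq with h'' | h''
              · have : 0 ≤ y * (β / α) := by positivity
                linarith
              · subst h''
                have : 0 < y * (β / α) := by positivity
                linarith
          · rw [max_eq_left (by positivity), min_eq_right h,
              max_eq_left (by have : 0 ≤ y := by linarith
                              positivity), min_eq_right (by linarith)]
            nlinarith
        rw [min_eq_left hx1.le]
        exact lt_min hx2 hx1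
      linarith
    · rcases lt_or_ge x T with hx' | hx'
      · have : max (min (x - α) (T - α)) 0 < max (min (y - α) (T - α)) 0 := by
          rw [min_eq_left (by linarith), max_eq_left (by linarith)]
          exact lt_of_lt_of_le (lt_min (by linarith) (by linarith)) (le_max_left _ _)
        have := mul_lt_mul_of_pos_right this p2
        linarith
      · have : max (x - T) 0 < max (y - T) 0 := by
          rw [max_eq_left (by linarith), max_eq_left (by linarith)]; linarith
        linarith
  · dsimp only
    rw [min_eq_left (a := (0:ℝ) - α) (by linarith), max_eq_right (a := (0:ℝ) - α) (by linarith),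
      max_eq_right (a := (0:ℝ) - T) (by linarith)]
    simp [h3.le]
  · dsimp only
    have e1 : α * (β / α) = β := by field_simp
    rw [e1, max_eq_left h3.le, min_eq_right h1.le, max_eq_right (a := α - T) (by linarith)]
    simp
  · intro f hf
    dsimp only
    have p1 : 0 < β / α := by positivity
    have e1 : α * (β / α) = β := by field_simp
    have e2 : (T - α) * ((T - β) / (T - α)) = T - β := by field_simp
    have q : β ≤ f * (β / α) := by
      calc β = α * (β / α) := e1.symm
        _ ≤ f * (β / α) := mul_le_mul_of_nonneg_right (by linarith) p1.le
    rw [max_eq_left (a := f * (β / α)) (by linarith), min_eq_right (a := f) (by linarith),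
      min_eq_right (by linarith), min_eq_right (a := f - α) (by linarith),
      max_eq_left (a := T - α) (by linarith), max_eq_left (a := f - T) (by linarith), e2]
    ring

lemma exists_phi (t : ℝ) (M : Finset ℝ) (hM : Inv t M) (a v : ℝ) (ha : t < a) (hv : t < v)
    (haM : ∀ μ ∈ M, a < μ) (hvM : ∀ μ ∈ M, v < μ) :
    ∃ φ : ℝ → ℝ, StrictMono φ ∧ (∀ y (k : ℕ), φ (y + k) = φ y + k) ∧ (∀ μ ∈ M, φ μ = μ) ∧
      φ a = v := by
  rcases M.eq_empty_or_nonempty with rfl | hne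
  · refine ⟨fun y => y + (v - a), fun x y h => by dsimp only; linarith, fun y k => by ring, by simp,
      by ring⟩
  obtain ⟨τ, hτ, hτm⟩ : ∃ τ ∈ M, ∀ μ ∈ M, τ ≤ μ := ⟨M.min' hne, M.min'_mem hne, fun μ h => M.min'_le μ h⟩
  have hτ1 : τ ≤ t + 1 := by
    rcases (hM τ hτ).2 with h | h
    · exact h
    · have := hτm _ h; linarith
  have hta := haM τ hτ
  have htv := hvM τ hτ
  obtain ⟨ψ, mono, ψ0, ψa, ψT⟩ := exists_psi (a - t) (v - t) (τ - t) (by linarith) (by linarith)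
    (by linarith) (by linarith)
  have ψ1 : ψ 1 = 1 := ψT 1 (by linarith)
  have per : ∀ y (k : ℕ), t + ⌊y + k - t⌋ + ψ (Int.fract (y + k - t)) =
      t + ⌊y - t⌋ + ψ (Int.fract (y - t)) + k := by
    intro y k
    have : y + k - t = (y - t) + (k : ℕ) := by ring
    rw [this, Int.floor_add_natCast, Int.fract_add_natCast]
    push_cast; ring
  have base : ∀ y, t < y → y ≤ t + 1 → t + ⌊y - t⌋ + ψ (Int.fract (y - t)) = t + ψ (y - t) := by
    intro y h1 h2
    rcases h2.lt_or_eq with h | h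
    · have e : ⌊y - t⌋ = 0 := Int.floor_eq_zero_iff.2 ⟨by linarith, by linarith⟩
      rw [e, Int.fract, e]; simp
    · subst h; simp [ψ0, ψ1]
  refine ⟨fun y => t + ⌊y - t⌋ + ψ (Int.fract (y - t)), ?_, per, ?_, ?_⟩
  · intro x y hxy
    dsimp only
    have hle : ⌊x - t⌋ ≤ ⌊y - t⌋ := Int.floor_le_floor (by linarith)
    rcases hle.lt_or_eq with h | h
    · have h' : ((⌊x - t⌋ : ℤ) : ℝ) + 1 ≤ ⌊y - t⌋ := by exact_mod_cast h
      have u1 : ψ (Int.fract (x - t)) < 1 := by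
        rw [← ψ1]; exact mono (Int.fract_lt_one _)
      have u2 : 0 ≤ ψ (Int.fract (y - t)) := by
        rw [← ψ0]; exact mono.monotone (Int.fract_nonneg _)
      linarith
    · rw [h]
      have : ψ (Int.fract (x - t)) < ψ (Int.fract (y - t)) := by
        apply mono
        rw [Int.fract, Int.fract, h]; linarith
      linarith
  · have key : ∀ (n : ℕ) μ, μ ∈ M → μ ≤ t + n → t + ⌊μ - t⌋ + ψ (Int.fract (μ - t)) = μ := by
      intro n
      induction n with
      | zero =>
        intro μ hμ h
        have := (hM μ hμ).1
        simp at h; linarith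
      | succ n ih =>
        intro μ hμ h
        push_cast at h
        rcases (hM μ hμ).2 with h' | h'
        · rw [base μ (hM μ hμ).1 h', ψT _ (by linarith [hτm μ hμ])]; ring
        · have := ih _ h' (by linarith)
          have p := per (μ - 1) 1
          simp only [Nat.cast_one, sub_add_cancel] at p
          rw [p, this]; ring
    intro μ hμ
    obtain ⟨n, hn⟩ := exists_nat_ge (μ - t)
    exact key n μ hμ (by linarith)
  · dsimp only
    rw [base a ha (by linarith), ψa]; ring

/-- Applying a periodic rescaling does not change the class. -/
lemma SRel_phi {m : ℕ} {A : Finset ι} {K : Finset ℝ} {φ : ℝ → ℝ} (h1 : StrictMono φ)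
    (h2 : ∀ y (k : ℕ), φ (y + k) = φ y + k) (h3 : ∀ μ ∈ K, φ μ = μ) (x : ι → ℝ) :
    SRel m A K x (fun i => φ (x i)) := by
  refine ⟨fun i _ j _ s _ _ => ?_, fun i _ μ hμ => ?_⟩
  · dsimp only
    rw [← h2, h1.lt_iff_lt, h1.lt_iff_lt]; simp
  · dsimp only
    constructor
    · conv_rhs => rw [← h3 μ hμ, h1.lt_iff_lt]
    · conv_rhs => rw [← h3 μ hμ, h1.lt_iff_lt]

/-! Invariants. -/

lemma Inv.not_mem {t : ℝ} {M : Finset ℝ} (h : Inv t M) {v : ℝ} (hv : t < v)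
    (hvM : ∀ μ ∈ M, v < μ) (k : ℕ) : v + k ∉ M := by
  induction k with
  | zero => intro hk; have := hvM _ hk; simp at this
  | succ k ih =>
    intro hk
    rcases (h _ hk).2 with h' | h'
    · push_cast at h'
      have : (0:ℝ) ≤ k := Nat.cast_nonneg k
      linarith
    · apply ih
      convert h' using 1
      push_cast; ring

lemma Inv.insert_seg {t : ℝ} {M : Finset ℝ} (h : Inv t M) {v : ℝ} (hv : t < v)
    (hvM : ∀ μ ∈ M, v < μ) (d : ℕ) : Inv v (M ∪ seg v d) := by
  intro μ hμ
  rcases Finset.mem_union.1 hμ with hμ | hμ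
  · refine ⟨hvM μ hμ, ?_⟩
    rcases (h μ hμ).2 with h' | h'
    · left; linarith
    · right; exact Finset.mem_union_left _ h'
  · obtain ⟨k, h1, h2, rfl⟩ := mem_seg.1 hμ
    have : (1:ℝ) ≤ k := by exact_mod_cast h1
    refine ⟨by linarith, ?_⟩
    rcases h1.eq_or_lt with rfl | h1
    · left; simp
    · right
      refine Finset.mem_union_right _ (mem_seg.2 ⟨k - 1, by omega, by omega, ?_⟩)
      rw [Nat.cast_sub (by omega)]; push_cast; ring

lemma Inv.JJ_seg {t : ℝ} {M : Finset ℝ} (h : Inv t M) {v : ℝ} (hv : t < v)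
    (hvM : ∀ μ ∈ M, v < μ) (d : ℕ) : JJ v (M ∪ seg v d) (v + d) := by
  refine ⟨h.insert_seg hv hvM d, by simp, fun k => ?_, fun k hk hm => ?_⟩
  · rcases lt_or_ge k d with hkd | hkd
    · left
      refine Finset.mem_union_right _ (mem_seg.2 ⟨d - k, by omega, by omega, ?_⟩)
      rw [Nat.cast_sub hkd.le]; ring
    · right
      have : (d:ℝ) ≤ k := by exact_mod_cast hkd
      linarith
  · rcases Finset.mem_union.1 hm with hm | hm
    · have := h.not_mem hv hvM (d + k)
      apply this
      push_cast
      rwa [← add_assoc]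
    · obtain ⟨l, h1, h2, h3⟩ := mem_seg.1 hm
      have : ((d + k : ℕ) : ℝ) = l := by push_cast; linarith
      have : d + k = l := by exact_mod_cast this
      omega

lemma JJ.Inv_seg {t : ℝ} {M : Finset ℝ} {a : ℝ} (h : JJ t M a) (d : ℕ) : Inv t (M ∪ seg a d) := by
  obtain ⟨h1, h2, h3, h4⟩ := h
  intro μ hμ
  rcases Finset.mem_union.1 hμ with hμ | hμ
  · refine ⟨(h1 μ hμ).1, ?_⟩
    rcases (h1 μ hμ).2 with h' | h'
    · left; exact h'
    · right; exact Finset.mem_union_left _ h'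
  · obtain ⟨k, k1, k2, rfl⟩ := mem_seg.1 hμ
    have : (1:ℝ) ≤ k := by exact_mod_cast k1
    refine ⟨by linarith, ?_⟩
    rcases k1.eq_or_lt with rfl | k1
    · rcases h3 0 with h | h
      · right; apply Finset.mem_union_left; simpa using h
      · left; simp at h ⊢; exact h
    · right
      refine Finset.mem_union_right _ (mem_seg.2 ⟨k - 1, by omega, by omega, ?_⟩)
      rw [Nat.cast_sub (by omega)]; push_cast; ring

lemma JJ.seg {t : ℝ} {M : Finset ℝ} {a : ℝ} (h : JJ t M a) (d : ℕ) :
    JJ t (M ∪ seg a d) (a + d) := by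
  have hI := h.Inv_seg d
  obtain ⟨h1, h2, h3, h4⟩ := h
  refine ⟨hI, ?_, fun k => ?_, fun k hk hm => ?_⟩
  · have : (0:ℝ) ≤ d := Nat.cast_nonneg d
    linarith
  · rcases lt_or_ge k d with hkd | hkd
    · left
      refine Finset.mem_union_right _ (mem_seg.2 ⟨d - k, by omega, by omega, ?_⟩)
      rw [Nat.cast_sub hkd.le]; ring
    · have e : a + d - k = a - ((k - d : ℕ) : ℝ) := by rw [Nat.cast_sub hkd]; ring
      rw [e]
      rcases h3 (k - d) with h | h
      · left; exact Finset.mem_union_left _ h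
      · right; exact h
  · rcases Finset.mem_union.1 hm with hm | hm
    · apply h4 (d + k) (by omega)
      push_cast
      rwa [← add_assoc]
    · obtain ⟨l, h1, h2, h3⟩ := mem_seg.1 hm
      have : ((d + k : ℕ) : ℝ) = l := by push_cast; linarith
      have : d + k = l := by exact_mod_cast this
      omega

lemma JJ.card {t : ℝ} {M : Finset ℝ} {a : ℝ} (h : JJ t M a) (d : ℕ) :
    (M ∪ Braid.seg a d).card = M.card + d := by
  rw [Finset.card_union_of_disjoint, card_seg]
  rw [Finset.disjoint_left]
  intro μ hμ hs
  obtain ⟨k, k1, k2, rfl⟩ := mem_seg.1 hs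
  exact h.2.2.2 k k1 hμ

lemma Inv.card {t : ℝ} {M : Finset ℝ} (h : Inv t M) {v : ℝ} (hv : t < v)
    (hvM : ∀ μ ∈ M, v < μ) (d : ℕ) : (M ∪ seg v d).card = M.card + d := by
  rw [Finset.card_union_of_disjoint, card_seg]
  rw [Finset.disjoint_left]
  intro μ hμ hs
  obtain ⟨k, k1, k2, rfl⟩ := mem_seg.1 hs
  exact h.not_mem hv hvM k hμ

lemma Inv.exists_v {t : ℝ} {M : Finset ℝ} (h : Inv t M) : ∃ v, t < v ∧ ∀ μ ∈ M, v < μ := by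
  rcases M.eq_empty_or_nonempty with rfl | hne
  · exact ⟨t + 1, by linarith, by simp⟩
  · have := (h _ (M.min'_mem hne)).1
    obtain ⟨v, h1, h2⟩ := exists_between this
    exact ⟨v, h1, fun μ hμ => h2.trans_le (M.min'_le μ hμ)⟩

lemma Inv.pop {t : ℝ} {M : Finset ℝ} (h : Inv t M) {τ : ℝ} (hτ : τ ∈ M) (hτm : ∀ μ ∈ M, τ ≤ μ) :
    Inv τ (M.erase τ) := by
  intro μ hμ
  obtain ⟨h1, h2⟩ := Finset.mem_erase.1 hμ
  have h3 := lt_of_le_of_ne (hτm μ h2) (Ne.symm h1)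
  refine ⟨h3, ?_⟩
  by_cases h4 : μ ≤ τ + 1
  · exact Or.inl h4
  · right
    push Not at h4
    refine Finset.mem_erase.2 ⟨by linarith, ?_⟩
    rcases (h μ h2).2 with h' | h'
    · have := (h τ hτ).1
      linarith
    · exact h'
end Geo2

section Geo3
variable {ι : Type*} [Fintype ι] [DecidableEq ι]

/-- Put the labels of `B` at position `p`. -/
noncomputable def glue (p : ℝ) (B : Finset ι) (y : ι → ℝ) : ι → ℝ := fun i => if i ∈ B then p else y i

lemma glue_pos {p : ℝ} {B : Finset ι} {y : ι → ℝ} {i : ι} (h : i ∈ B) : glue p B y i = p := if_pos h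
lemma glue_neg {p : ℝ} {B : Finset ι} {y : ι → ℝ} {i : ι} (h : i ∉ B) : glue p B y i = y i :=
  if_neg h

lemma glue_self {p : ℝ} {B : Finset ι} {y : ι → ℝ} (h : ∀ i ∈ B, y i = p) : glue p B y = y := by
  funext i
  by_cases hi : i ∈ B
  · rw [glue_pos hi, h i hi]
  · rw [glue_neg hi]

lemma SRel_glue {m : ℕ} {A B : Finset ι} {t p : ℝ} {K K' : Finset ℝ} (hB : B.Nonempty)
    (hBA : B ⊆ A)
    (hp1 : ∀ s : ℕ, 1 ≤ s → s ≤ m → p + s ∈ K')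
    (hp2 : ∀ s : ℕ, 1 ≤ s → s ≤ m → p - s ∈ K' ∨ p - s ≤ t)
    (hK : K ⊆ K') (hK' : K' ⊆ K ∪ seg p m) {y z : ι → ℝ}
    (hy : ∀ i ∈ A \ B, t < y i) (hz : ∀ i ∈ A \ B, t < z i) :
    SRel m (A \ B) K' y z ↔ SRel m A K (glue p B y) (glue p B z) := by
  constructor
  · intro h
    refine ⟨fun i hi j hj s h1 h2 => ?_, fun i hi μ hμ => ?_⟩
    · by_cases hiB : i ∈ B
      · by_cases hjB : j ∈ B
        · simp only [glue_pos hiB, glue_pos hjB]; simp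
        · simp only [glue_pos hiB, glue_neg hjB]
          have hj' : j ∈ A \ B := Finset.mem_sdiff.2 ⟨hj, hjB⟩
          have hyj := hy j hj'
          have hzj := hz j hj'
          rw [← sub_lt_iff_lt_add, ← sub_lt_iff_lt_add, ← lt_sub_iff_add_lt, ← lt_sub_iff_add_lt]
          rcases hp2 s h1 h2 with h' | h'
          · exact ⟨(h.2 j hj' _ h').2, (h.2 j hj' _ h').1⟩
          · exact ⟨⟨fun _ => by linarith, fun _ => by linarith⟩,
              ⟨fun _ => by linarith, fun _ => by linarith⟩⟩
      · have hi' : i ∈ A \ B := Finset.mem_sdiff.2 ⟨hi, hiB⟩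
        by_cases hjB : j ∈ B
        · simp only [glue_neg hiB, glue_pos hjB]
          exact h.2 i hi' _ (hp1 s h1 h2)
        · simp only [glue_neg hiB, glue_neg hjB]
          exact h.1 i hi' j (Finset.mem_sdiff.2 ⟨hj, hjB⟩) s h1 h2
    · by_cases hiB : i ∈ B
      · simp only [glue_pos hiB]; simp
      · simp only [glue_neg hiB]
        exact h.2 i (Finset.mem_sdiff.2 ⟨hi, hiB⟩) μ (hK hμ)
  · intro h
    refine ⟨fun i hi j hj s h1 h2 => ?_, fun i hi μ hμ => ?_⟩
    · obtain ⟨hi, hiB⟩ := Finset.mem_sdiff.1 hi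
      obtain ⟨hj, hjB⟩ := Finset.mem_sdiff.1 hj
      have := h.1 i hi j hj s h1 h2
      simpa only [glue_neg hiB, glue_neg hjB] using this
    · obtain ⟨hi, hiB⟩ := Finset.mem_sdiff.1 hi
      rcases Finset.mem_union.1 (hK' hμ) with hμ | hμ
      · have := h.2 i hi μ hμ
        simpa only [glue_neg hiB] using this
      · obtain ⟨s, h1, h2, rfl⟩ := mem_seg.1 hμ
        obtain ⟨b, hb⟩ := hB
        have := h.1 i hi b (hBA hb) s h1 h2
        simpa only [glue_neg hiB, glue_pos hb] using this

/-- Indicator of nonemptyness. -/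
noncomputable def e0 (B : Finset ι) : Polynomial ℚ := if B = ∅ then 0 else 1

/-- Transport for completed chains. -/
lemma cnt_complete (m : ℕ) (A : Finset ι) (t : ℝ) (M L : Finset ℝ) :
    cnt (sSet m A (M ∪ L)) (wt m A L) {x | x ∈ Dom A t M ∧ ∀ i ∈ A, x i ∉ L} =
      NN m A t (M ∪ L) ∅ := by
  unfold NN
  rw [cnt_transport (sSet m A (M ∪ L)) (sSet m A (M ∪ L ∪ ∅)) (wt m A L) (wt m A ∅)
    (wt_congr Finset.subset_union_right) (wt_congr (Finset.empty_subset _)) _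
    (Dom A t (M ∪ L)) id 1 ?_ ?_ ?_ ?_, one_mul]
  · intro y hy
    refine ⟨y, ⟨fun i hi => ⟨(hy i hi).1, fun h => (hy i hi).2 (Finset.mem_union_left _ h)⟩,
      fun i hi h => (hy i hi).2 (Finset.mem_union_right _ h)⟩, SRel.refl y⟩
  · intro y _ z _
    rw [Finset.union_empty]; rfl
  · intro x hx
    refine ⟨x, fun i hi => ⟨(hx.1 i hi).1, fun h => ?_⟩, SRel.refl x⟩
    rcases Finset.mem_union.1 h with h | h
    · exact (hx.1 i hi).2 h
    · exact hx.2 i hi h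
  · intro y hy
    have : VS m A L y = VS m A ∅ y := by
      ext g
      rw [mem_VS, mem_VS]
      refine and_congr Iff.rfl (and_congr Iff.rfl ?_)
      constructor
      · intro _ i _ h; simp at h
      · intro _ i hi h; exact absurd (Finset.mem_union_right _ h) (hy i hi).2
    rw [one_mul, id, wt, wt, this]

lemma cnt_open_step (m : ℕ) (A B : Finset ι) (t a : ℝ) (M : Finset ℝ) (hJ : JJ t M a)
    (hB : B.Nonempty) (hBA : B ⊆ A) (d : ℕ) (hd1 : 1 ≤ d) (hdm : d ≤ m) :
    cnt (sSet m A (M ∪ seg a m)) (wt m A (seg a m))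
      {x | (∀ i ∈ B, x i = a + d) ∧ ∀ i ∈ A \ B, t < x i ∧ x i ∉ M ∪ seg a d} =
      NN m (A \ B) t (M ∪ seg a d) (seg (a + d) m) := by
  obtain ⟨hI, hta, hlow, hhigh⟩ := hJ
  have hlow' : ∀ s : ℕ, 1 ≤ s → s ≤ m → a + d - s ∈ M ∪ seg a d ∨ a + d - s ≤ t := by
    intro s h1 h2
    rcases lt_or_ge s d with h | h
    · left
      refine Finset.mem_union_right _ (mem_seg.2 ⟨d - s, by omega, by omega, ?_⟩)
      rw [Nat.cast_sub h.le]; ring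
    · have e : a + d - s = a - ((s - d : ℕ) : ℝ) := by rw [Nat.cast_sub h]; ring
      rw [e]
      rcases hlow (s - d) with h | h
      · left; exact Finset.mem_union_left _ h
      · right; exact h
  have hsplit : ∀ k : ℕ, 1 ≤ k → k ≤ m → a + k ∈ seg a d ∨ a + k ∈ seg (a + d) m := by
    intro k h1 h2
    rcases le_or_gt k d with h | h
    · left; exact mem_seg.2 ⟨k, h1, h, rfl⟩
    · right
      refine mem_seg.2 ⟨k - d, by omega, by omega, ?_⟩
      rw [Nat.cast_sub h.le]; ring
  unfold NN
  rw [cnt_transport (sSet m A (M ∪ seg a m)) (sSet m (A \ B) (M ∪ seg a d ∪ seg (a + d) m))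
    (wt m A (seg a m)) (wt m (A \ B) (seg (a + d) m))
    (wt_congr Finset.subset_union_right) (wt_congr Finset.subset_union_right) _
    (Dom (A \ B) t (M ∪ seg a d)) (glue (a + d) B) 1 ?_ ?_ ?_ ?_, one_mul]
  · intro y hy
    refine ⟨_, ⟨fun i hi => glue_pos hi, fun i hi => ?_⟩, SRel.refl _⟩
    rw [glue_neg (Finset.mem_sdiff.1 hi).2]
    exact hy i hi
  · intro y hy z hz
    refine SRel_glue (t := t) hB hBA ?_ ?_ ?_ ?_ (fun i hi => (hy i hi).1) (fun i hi => (hz i hi).1)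
    · intro s h1 h2
      exact Finset.mem_union_right _ (mem_seg.2 ⟨s, h1, h2, rfl⟩)
    · intro s h1 h2
      rcases hlow' s h1 h2 with h | h
      · left; exact Finset.mem_union_left _ h
      · right; exact h
    · intro μ hμ
      rcases Finset.mem_union.1 hμ with h | h
      · exact Finset.mem_union_left _ (Finset.mem_union_left _ h)
      · obtain ⟨k, h1, h2, rfl⟩ := mem_seg.1 h
        rcases hsplit k h1 h2 with h | h
        · exact Finset.mem_union_left _ (Finset.mem_union_right _ h)
        · exact Finset.mem_union_right _ h
    · intro μ hμ
      rcases Finset.mem_union.1 hμ with h | h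
      · rcases Finset.mem_union.1 h with h | h
        · exact Finset.mem_union_left _ (Finset.mem_union_left _ h)
        · obtain ⟨k, h1, h2, rfl⟩ := mem_seg.1 h
          exact Finset.mem_union_left _ (Finset.mem_union_right _
            (mem_seg.2 ⟨k, h1, by omega, rfl⟩))
      · exact Finset.mem_union_right _ h
  · intro x hx
    refine ⟨x, fun i hi => hx.2 i hi, ?_⟩
    rw [glue_self hx.1]
  · intro y hy
    obtain ⟨b, hb⟩ := hB
    have : VS m A (seg a m) (glue (a + d) B y) = VS m (A \ B) (seg (a + d) m) y := by
      ext g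
      rw [mem_VS, mem_VS]
      constructor
      · rintro ⟨g1, g2, g3⟩
        have gB : ∀ i ∈ B, g i = 0 := fun i hi =>
          g3 i (hBA hi) (by rw [glue_pos hi]; exact mem_seg.2 ⟨d, hd1, hdm, rfl⟩)
        refine ⟨fun i hi => ?_, fun i hi j hj s h1 h2 e => ?_, fun i hi h => ?_⟩
        · by_cases hiB : i ∈ B
          · exact gB i hiB
          · exact g1 i fun h => hi (Finset.mem_sdiff.2 ⟨h, hiB⟩)
        · obtain ⟨hi, hiB⟩ := Finset.mem_sdiff.1 hi
          obtain ⟨hj, hjB⟩ := Finset.mem_sdiff.1 hj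
          exact g2 i hi j hj s h1 h2 (by rw [glue_neg hiB, glue_neg hjB, e])
        · obtain ⟨hi, hiB⟩ := Finset.mem_sdiff.1 hi
          obtain ⟨s, h1, h2, e⟩ := mem_seg.1 h
          rw [g2 i hi b (hBA hb) s h1 h2 (by rw [glue_neg hiB, glue_pos hb, e]), gB b hb]
      · rintro ⟨g1, g2, g3⟩
        have gB : ∀ i ∈ B, g i = 0 := fun i hi => g1 i (by simp [hi])
        refine ⟨fun i hi => g1 i (by simp [hi]), fun i hi j hj s h1 h2 e => ?_, fun i hi h => ?_⟩
        · by_cases hiB : i ∈ B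
          · by_cases hjB : j ∈ B
            · rw [gB i hiB, gB j hjB]
            · rw [glue_pos hiB, glue_neg hjB] at e
              exfalso
              have hj' := hy j (Finset.mem_sdiff.2 ⟨hj, hjB⟩)
              have e' : a + d - s = y j := by linarith
              rcases hlow' s h1 h2 with h | h
              · rw [e'] at h; exact hj'.2 h
              · linarith [hj'.1]
          · have hi' : i ∈ A \ B := Finset.mem_sdiff.2 ⟨hi, hiB⟩
            by_cases hjB : j ∈ B
            · rw [glue_neg hiB, glue_pos hjB] at e
              rw [g3 i hi' (mem_seg.2 ⟨s, h1, h2, e⟩), gB j hjB]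
            · rw [glue_neg hiB, glue_neg hjB] at e
              exact g2 i hi' j (Finset.mem_sdiff.2 ⟨hj, hjB⟩) s h1 h2 e
        · by_cases hiB : i ∈ B
          · exact gB i hiB
          · have hi' : i ∈ A \ B := Finset.mem_sdiff.2 ⟨hi, hiB⟩
            rw [glue_neg hiB] at h
            obtain ⟨k, h1, h2, e⟩ := mem_seg.1 h
            apply g3 i hi'
            rcases hsplit k h1 h2 with h | h
            · rw [← e] at h
              exact absurd (Finset.mem_union_right _ h) (hy i hi').2
            · rwa [e]
    rw [one_mul, wt, wt, this]

lemma NN_open (m : ℕ) (A : Finset ι) (t a : ℝ) (M : Finset ℝ) (hJ : JJ t M a) :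
    NN m A t M (seg a m) = NN m A t (M ∪ seg a m) ∅ +
      ∑ d ∈ Finset.Icc 1 m, ∑ B ∈ A.powerset,
        e0 B * NN m (A \ B) t (M ∪ seg a d) (seg (a + d) m) := by
  have main := cnt_ie (sSet m A (M ∪ seg a m)) (wt m A (seg a m))
    (Finset.disjSum ({()} : Finset Unit) (Finset.Icc 1 m ×ˢ A.powerset))
    (Sum.elim (fun _ => 1) (fun p => e0 p.2)) (Dom A t M)
    (Sum.elim (fun _ => {x | x ∈ Dom A t M ∧ ∀ i ∈ A, x i ∉ seg a m})
      (fun p => {x | (∀ i ∈ p.2, x i = a + p.1) ∧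
        ∀ i ∈ A \ p.2, t < x i ∧ x i ∉ M ∪ seg a p.1})) ?_ ?_
  · change NN m A t M (seg a m) = _ at main
    rw [main, Finset.sum_disjSum, Finset.sum_product]
    simp only [Sum.elim_inl, Sum.elim_inr, Finset.sum_singleton, one_mul]
    rw [cnt_complete]
    refine congrArg (fun z => NN m A t (M ∪ seg a m) ∅ + z) ?_
    refine Finset.sum_congr rfl fun d hd => Finset.sum_congr rfl fun B hB => ?_
    obtain ⟨hd1, hd2⟩ := Finset.mem_Icc.1 hd
    rcases B.eq_empty_or_nonempty with rfl | hne
    · simp [e0]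
    · rw [cnt_open_step m A B t a M hJ hne (Finset.mem_powerset.1 hB) d hd1 hd2]
  · rintro (e | ⟨d, B⟩) he y hy
    · exact ⟨y, hy.1, SRel.refl y⟩
    · refine ⟨y, fun i hi => ?_, SRel.refl y⟩
      simp only [Finset.inr_mem_disjSum, Finset.mem_product, Finset.mem_Icc] at he
      by_cases hiB : i ∈ B
      · rw [hy.1 i hiB]
        refine ⟨?_, hJ.2.2.2 d he.1.1⟩
        have : (1:ℝ) ≤ d := by exact_mod_cast he.1.1
        have := hJ.2.1
        simp only
        linarith
      · have := hy.2 i (Finset.mem_sdiff.2 ⟨hi, hiB⟩)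
        exact ⟨this.1, fun h => this.2 (Finset.mem_union_left _ h)⟩
  · intro x hx
    rw [Finset.sum_disjSum]
    simp only [Sum.elim_inl, Sum.elim_inr, Finset.sum_singleton]
    by_cases hc : ∀ i ∈ A, x i ∉ seg a m
    · rw [ind_pos ⟨x, ⟨hx, hc⟩, SRel.refl x⟩, Finset.sum_eq_zero, add_zero]
      rintro ⟨d, B⟩ he
      simp only [Finset.mem_product, Finset.mem_Icc, Finset.mem_powerset] at he
      rcases B.eq_empty_or_nonempty with rfl | ⟨b, hb⟩
      · simp [e0, ind]
      · rw [ind_neg]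
        rintro ⟨y, hy, hxy⟩
        have hm : a + (d : ℝ) ∈ seg a m := mem_seg.2 ⟨d, he.1.1, he.1.2, rfl⟩
        have := (SRel.mark_iff hxy (he.2 hb) (Finset.mem_union_right _ hm)).2 (hy.1 b hb)
        exact hc b (he.2 hb) (this ▸ hm)
    · rw [ind_neg, zero_add]
      swap
      · rintro ⟨y, hy, hxy⟩
        push Not at hc
        obtain ⟨i, hi, his⟩ := hc
        have := (SRel.mark_iff hxy hi (Finset.mem_union_right _ his)).1 rfl
        exact hy.2 i hi (this ▸ his)
      have hex : ∃ d : ℕ, 1 ≤ d ∧ d ≤ m ∧ ∃ i ∈ A, x i = a + d := by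
        push Not at hc
        obtain ⟨i, hi, his⟩ := hc
        obtain ⟨d, h1, h2, h3⟩ := mem_seg.1 his
        exact ⟨d, h1, h2, i, hi, h3⟩
      obtain ⟨h1, h2, i0, hi0, e0'⟩ := Nat.find_spec hex
      have hmin := fun k => Nat.find_min hex (m := k)
      generalize Nat.find hex = d at *
      rw [Finset.sum_eq_single (d, A.filter (fun i => x i = a + d))]
      · rw [ind_pos]
        · simp only [e0]
          rw [if_neg]
          exact Finset.Nonempty.ne_empty ⟨i0, Finset.mem_filter.2 ⟨hi0, e0'⟩⟩
        · refine ⟨x, ⟨fun i hi => (Finset.mem_filter.1 hi).2, fun i hi => ?_⟩, SRel.refl x⟩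
          obtain ⟨hiA, hiB⟩ := Finset.mem_sdiff.1 hi
          refine ⟨(hx i hiA).1, fun h => ?_⟩
          rcases Finset.mem_union.1 h with h | h
          · exact (hx i hiA).2 h
          · obtain ⟨k, k1, k2, k3⟩ := mem_seg.1 h
            simp only at k2
            rcases k2.lt_or_eq with k2 | rfl
            · exact hmin k k2 ⟨k1, by omega, i, hiA, k3⟩
            · exact hiB (Finset.mem_filter.2 ⟨hiA, k3⟩)
      · rintro ⟨d', B⟩ he hne
        simp only [Finset.mem_product, Finset.mem_Icc, Finset.mem_powerset] at he
        rcases B.eq_empty_or_nonempty with rfl | ⟨b, hb⟩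
        · simp [e0, ind]
        rw [ind_neg]
        rintro ⟨y, hy, hxy⟩
        simp only [Set.mem_setOf_eq] at hy
        have key : ∀ i ∈ A, ∀ k : ℕ, 1 ≤ k → k ≤ m → (x i = a + k ↔ y i = a + k) :=
          fun i hi k k1 k2 => SRel.mark_iff hxy hi
            (Finset.mem_union_right _ (mem_seg.2 ⟨k, k1, k2, rfl⟩))
        have hxb : x b = a + d' := (key b (he.2 hb) d' he.1.1 he.1.2).2 (hy.1 b hb)
        have hle : d ≤ d' := not_lt.1 fun hlt => hmin d' hlt ⟨he.1.1, he.1.2, b, he.2 hb, hxb⟩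
        have hyi0 := (key i0 hi0 d h1 h2).1 e0'
        have hge : d' ≤ d := by
          by_cases hiB : i0 ∈ B
          · have := hy.1 i0 hiB
            have : (d : ℝ) = d' := by linarith
            exact le_of_eq (by exact_mod_cast this.symm)
          · by_contra hlt
            push Not at hlt
            refine (hy.2 i0 (Finset.mem_sdiff.2 ⟨hi0, hiB⟩)).2 (Finset.mem_union_right _ ?_)
            exact mem_seg.2 ⟨d, h1, hlt.le, hyi0⟩
        obtain rfl : d' = d := le_antisymm hge hle
        apply hne
        congr 1
        ext i
        rw [Finset.mem_filter]
        constructor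
        · intro hi
          exact ⟨he.2 hi, (key i (he.2 hi) d' h1 h2).2 (hy.1 i hi)⟩
        · rintro ⟨hi, hxi⟩
          by_contra hiB
          refine (hy.2 i (Finset.mem_sdiff.2 ⟨hi, hiB⟩)).2 (Finset.mem_union_right _ ?_)
          exact mem_seg.2 ⟨d', h1, le_rfl, (key i hi d' h1 h2).1 hxi⟩
      · intro h
        exfalso
        apply h
        simp only [Finset.mem_product, Finset.mem_Icc, Finset.mem_powerset]
        exact ⟨⟨h1, h2⟩, Finset.filter_subset _ _⟩
end Geo3

section Geo4
variable {ι : Type*} [Fintype ι] [DecidableEq ι]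

/-- Configurations all of whose points are beyond the first mark. -/
def DP (A : Finset ι) (t : ℝ) (M : Finset ℝ) : Set (ι → ℝ) :=
  {x | x ∈ Dom A t M ∧ ∀ i ∈ A, ∃ μ ∈ M, μ < x i}

/-- Configurations where the block `E` sits at `v` and is free. -/
def DE (m : ℕ) (A : Finset ι) (M : Finset ℝ) (v : ℝ) (E : Finset ι) : Set (ι → ℝ) :=
  {x | (∀ i ∈ E, x i = v) ∧ ∀ i ∈ A \ E, v < x i ∧ x i ∉ M ∪ seg v m}

/-- Configurations where the block `B` sits at `v` and is bound. -/
def DB (m : ℕ) (A : Finset ι) (M : Finset ℝ) (v : ℝ) (B : Finset ι) : Set (ι → ℝ) :=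
  {x | (∀ i ∈ B, x i = v) ∧ (∀ i ∈ A \ B, v < x i ∧ x i ∉ M) ∧ ∃ i ∈ A \ B, x i ∈ seg v m}

lemma DE.ge {m : ℕ} {A : Finset ι} {M : Finset ℝ} {v : ℝ} {E : Finset ι} {x : ι → ℝ}
    (h : x ∈ DE m A M v E) {i : ι} (hi : i ∈ A) : v ≤ x i := by
  by_cases hE : i ∈ E
  · exact (h.1 i hE).ge
  · exact (h.2 i (Finset.mem_sdiff.2 ⟨hi, hE⟩)).1.le

lemma DB.ge {m : ℕ} {A : Finset ι} {M : Finset ℝ} {v : ℝ} {E : Finset ι} {x : ι → ℝ}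
    (h : x ∈ DB m A M v E) {i : ι} (hi : i ∈ A) : v ≤ x i := by
  by_cases hE : i ∈ E
  · exact (h.1 i hE).ge
  · exact (h.2.1 i (Finset.mem_sdiff.2 ⟨hi, hE⟩)).1.le

lemma DE.dom {m : ℕ} {A : Finset ι} {M : Finset ℝ} {t v : ℝ} {E : Finset ι} {x : ι → ℝ}
    (hv : t < v) (hvM : ∀ μ ∈ M, v < μ) (h : x ∈ DE m A M v E) : x ∈ Dom A t M := by
  intro i hi
  refine ⟨hv.trans_le (DE.ge h hi), fun hm => ?_⟩
  by_cases hE : i ∈ E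
  · rw [h.1 i hE] at hm; exact lt_irrefl _ (hvM _ hm)
  · exact (h.2 i (Finset.mem_sdiff.2 ⟨hi, hE⟩)).2 (Finset.mem_union_left _ hm)

lemma DB.dom {m : ℕ} {A : Finset ι} {M : Finset ℝ} {t v : ℝ} {E : Finset ι} {x : ι → ℝ}
    (hv : t < v) (hvM : ∀ μ ∈ M, v < μ) (h : x ∈ DB m A M v E) : x ∈ Dom A t M := by
  intro i hi
  refine ⟨hv.trans_le (DB.ge h hi), fun hm => ?_⟩
  by_cases hE : i ∈ E
  · rw [h.1 i hE] at hm; exact lt_irrefl _ (hvM _ hm)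
  · exact (h.2.1 i (Finset.mem_sdiff.2 ⟨hi, hE⟩)).2 hm

lemma F1 {m : ℕ} {A : Finset ι} {M : Finset ℝ} {t v : ℝ} {x y : ι → ℝ} {i : ι} (hi : i ∈ A)
    (hvM : ∀ μ ∈ M, v < μ) (hx : x ∈ DP A t M) (h : SRel m A M x y) (hy : y i = v) : False := by
  obtain ⟨μ, hμ, hlt⟩ := hx.2 i hi
  have := (h.2 i hi μ hμ).2.1 hlt
  have := hvM μ hμ
  linarith

lemma F2 {m : ℕ} {A : Finset ι} {M : Finset ℝ} {v : ℝ} {E B : Finset ι} {y y' : ι → ℝ}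
    (hE : E.Nonempty) (hEA : E ⊆ A) (hB : B.Nonempty) (hBA : B ⊆ A)
    (hy : y ∈ DE m A M v E) (hy' : y' ∈ DB m A M v B) (h : SRel m A M y y') : False := by
  obtain ⟨e, he⟩ := hE
  obtain ⟨b, hb⟩ := hB
  obtain ⟨b1, hb1, hs⟩ := hy'.2.2
  obtain ⟨d, d1, d2, hd⟩ := mem_seg.1 hs
  have hb1A := (Finset.mem_sdiff.1 hb1).1
  have hyb := hy'.1 b hb
  have hye := hy.1 e he
  have h1 : y b1 = y b + d := (h.eq_iff hb1A (hBA hb) d1 d2).2 (by rw [hd, hyb])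
  have hd0 : (1:ℝ) ≤ d := by exact_mod_cast d1
  have hbv := DE.ge hy (hBA hb)
  by_cases hb1E : b1 ∈ E
  · have := hy.1 b1 hb1E
    linarith
  · by_cases hbE : b ∈ E
    · have := hy.1 b hbE
      refine (hy.2 b1 (Finset.mem_sdiff.2 ⟨hb1A, hb1E⟩)).2 (Finset.mem_union_right _ ?_)
      exact mem_seg.2 ⟨d, d1, d2, by rw [h1, this]⟩
    · have hlt := (hy.2 b (Finset.mem_sdiff.2 ⟨hBA hb, hbE⟩)).1
      have := (h.1 b1 hb1A e (hEA he) d d1 d2).2.1 (by linarith)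
      have := DB.ge hy' (hEA he)
      linarith

lemma F3 {m : ℕ} {A : Finset ι} {M : Finset ℝ} {v : ℝ} {B B' : Finset ι} {y y' : ι → ℝ}
    (hB : B.Nonempty) (hBA : B ⊆ A) (hBA' : B' ⊆ A)
    (hy : y ∈ DB m A M v B) (hy' : y' ∈ DB m A M v B') (h : SRel m A M y y') : B' ⊆ B := by
  intro b' hb'
  obtain ⟨b, hb⟩ := hB
  obtain ⟨b1, hb1, hs⟩ := hy.2.2
  obtain ⟨d, d1, d2, hd⟩ := mem_seg.1 hs
  have hb1A := (Finset.mem_sdiff.1 hb1).1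
  have hyb := hy.1 b hb
  have h1 : y' b1 = y' b + d := (h.eq_iff hb1A (hBA hb) d1 d2).1 (by rw [hd, hyb])
  have h2 := DB.ge hy' (hBA hb)
  have h3 := hy'.1 b' hb'
  have h4 : ¬ y b1 < y b' + d := fun hc => by
    have := (h.1 b1 hb1A b' (hBA' hb') d d1 d2).1.1 hc
    linarith
  by_contra hc
  have := (hy.2.1 b' (Finset.mem_sdiff.2 ⟨hBA' hb', hc⟩)).1
  exact h4 (by linarith)

lemma F4 {m : ℕ} {A : Finset ι} {M : Finset ℝ} {t v : ℝ} (hI : Inv t M) (hv : t < v)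
    (hvM : ∀ μ ∈ M, v < μ) {x : ι → ℝ} (hx : x ∈ Dom A t M) (hnp : x ∉ DP A t M) :
    ∃ B, B.Nonempty ∧ B ⊆ A ∧ ∃ z, SRel m A M x z ∧ (z ∈ DE m A M v B ∨ z ∈ DB m A M v B) := by
  have : ∃ i ∈ A, ∀ μ ∈ M, x i < μ := by
    by_contra hc
    push Not at hc
    refine hnp ⟨hx, fun i hi => ?_⟩
    obtain ⟨μ, hμ, hle⟩ := hc i hi
    exact ⟨μ, hμ, lt_of_le_of_ne hle fun e => (hx i hi).2 (e ▸ hμ)⟩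
  obtain ⟨i1, hi1, hlt⟩ := this
  obtain ⟨i0, hi0, hmin⟩ := Finset.exists_min_image A x ⟨i1, hi1⟩
  obtain ⟨φ, p1, p2, p3, p4⟩ := exists_phi t M hI (x i0) v (hx i0 hi0).1 hv
    (fun μ hμ => (hmin i1 hi1).trans_lt (hlt μ hμ)) hvM
  have hS := SRel_phi (m := m) (A := A) p1 p2 p3 x
  have hout : ∀ i ∈ A \ A.filter (fun i => φ (x i) = v), v < φ (x i) ∧ φ (x i) ∉ M := by
    intro i hi
    simp only [Finset.mem_sdiff, Finset.mem_filter, not_and] at hi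
    refine ⟨lt_of_le_of_ne ?_ (Ne.symm (hi.2 hi.1)), fun hm => ?_⟩
    · rw [← p4]; exact p1.monotone (hmin i hi.1)
    · have := (hS.mark_iff hi.1 hm).2 rfl
      exact (hx i hi.1).2 (this ▸ hm)
  refine ⟨A.filter (fun i => φ (x i) = v), ⟨i0, Finset.mem_filter.2 ⟨hi0, p4⟩⟩,
    Finset.filter_subset _ _, _, hS, ?_⟩
  by_cases hc : ∃ i ∈ A \ A.filter (fun i => φ (x i) = v), φ (x i) ∈ seg v m
  · right
    exact ⟨fun i hi => (Finset.mem_filter.1 hi).2, hout, hc⟩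
  · left
    refine ⟨fun i hi => (Finset.mem_filter.1 hi).2, fun i hi => ⟨(hout i hi).1, fun hm => ?_⟩⟩
    rcases Finset.mem_union.1 hm with hm | hm
    · exact (hout i hi).2 hm
    · exact hc ⟨i, hi, hm⟩

lemma exists_close (S : Finset ℝ) (v : ℝ) : ∃ c < v, ∀ a ∈ S, a < v → a < c := by
  induction S using Finset.induction_on with
  | empty => exact ⟨v - 1, by linarith, by simp⟩
  | insert a S _ ih =>
    obtain ⟨c, hc, h⟩ := ih
    by_cases ha : a < v
    · obtain ⟨c', h1, h2⟩ := exists_between (max_lt hc ha)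
      refine ⟨c', h2, fun b hb hbv => ?_⟩
      rcases Finset.mem_insert.1 hb with rfl | hb
      · exact (le_max_right _ _).trans_lt h1
      · exact (h b hb hbv).trans ((le_max_left _ _).trans_lt h1)
    · refine ⟨c, hc, fun b hb hbv => ?_⟩
      rcases Finset.mem_insert.1 hb with rfl | hb
      · exact absurd hbv ha
      · exact h b hb hbv

lemma F5 {m : ℕ} {A : Finset ι} {M : Finset ℝ} {t v : ℝ} (hI : Inv t M) (hv : t < v)
    (hvM : ∀ μ ∈ M, v < μ) {E E' E'' : Finset ι} (hE : E.Nonempty) (hEA : E ⊆ A) (hEA' : E' ⊆ A)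
    (hE'' : E'' ⊆ E ∪ E') {y y' : ι → ℝ}
    (hy : y ∈ DE m A M v E) (hy' : y' ∈ DE m A M v E') (h : SRel m A M y y') :
    ∃ z ∈ DE m A M v E'', SRel m A M y z := by
  obtain ⟨e, he⟩ := hE
  have hye := hy.1 e he
  have hUA : E ∪ E' ⊆ A := Finset.union_subset hEA hEA'
  have ha : ∀ i ∈ E ∪ E', ∀ k ∈ A, ∀ s : ℕ, 1 ≤ s → s ≤ m → (y k < y i + s ↔ y k < v + s) := by
    intro i hi k hk s h1 h2
    rcases Finset.mem_union.1 hi with hi | hi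
    · rw [hy.1 i hi]
    · constructor
      · intro hlt
        have a1 := (h.1 k hk i (hEA' hi) s h1 h2).1.1 hlt
        rw [hy'.1 i hi] at a1
        have a2 := DE.ge hy' (hEA he)
        have := (h.1 k hk e (hEA he) s h1 h2).1.2 (by linarith)
        rwa [hye] at this
      · intro hlt
        have := DE.ge hy (hEA' hi)
        linarith
  have hb : ∀ i ∈ E ∪ E', ∀ k ∈ A, ∀ s : ℕ, 1 ≤ s → s ≤ m → (y i + s < y k ↔ v + s < y k) := by
    intro i hi k hk s h1 h2
    rcases Finset.mem_union.1 hi with hi | hi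
    · rw [hy.1 i hi]
    · constructor
      · intro hlt
        have := DE.ge hy (hEA' hi)
        linarith
      · intro hlt
        have a1 := (h.1 k hk e (hEA he) s h1 h2).2.1 (by rwa [hye])
        have a2 := DE.ge hy' (hEA he)
        have := (h.1 k hk i (hEA' hi) s h1 h2).2.2 (by rw [hy'.1 i hi]; linarith)
        exact this
  have hc : ∀ i ∈ E ∪ E', ∀ k ∈ A, ∀ s : ℕ, 1 ≤ s → s ≤ m → y i < y k + s := by
    intro i hi k hk s h1 h2
    have hs : (1:ℝ) ≤ s := by exact_mod_cast h1
    rcases Finset.mem_union.1 hi with hi | hi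
    · rw [hy.1 i hi]
      have := DE.ge hy hk
      linarith
    · refine (h.1 i (hEA' hi) k hk s h1 h2).1.2 ?_
      rw [hy'.1 i hi]
      have := DE.ge hy' hk
      linarith
  have hmk : ∀ i ∈ E ∪ E', ∀ μ ∈ M, y i < μ := by
    intro i hi μ hμ
    rcases Finset.mem_union.1 hi with hi | hi
    · rw [hy.1 i hi]; exact hvM μ hμ
    · refine (h.2 i (hEA' hi) μ hμ).1.2 ?_
      rw [hy'.1 i hi]; exact hvM μ hμ
  have hne : ∀ k ∈ A, ∀ s : ℕ, 1 ≤ s → s ≤ m → y k ≠ v + s := by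
    intro k hk s h1 h2 hks
    have hs : (1:ℝ) ≤ s := by exact_mod_cast h1
    by_cases hkE : k ∈ E
    · have := hy.1 k hkE
      linarith
    · exact (hy.2 k (Finset.mem_sdiff.2 ⟨hk, hkE⟩)).2
        (Finset.mem_union_right _ (mem_seg.2 ⟨s, h1, h2, hks⟩))
  obtain ⟨c, hcv, hcl⟩ := exists_close
    (insert t ((A ×ˢ Finset.Icc 1 m).image (fun p : ι × ℕ => y p.1 - (p.2 : ℝ)))) v
  have htc : t < c := hcl t (Finset.mem_insert_self _ _) hv
  have hc1 : ∀ k ∈ A, ∀ s : ℕ, 1 ≤ s → s ≤ m → y k < v + s → y k < c + s := by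
    intro k hk s h1 h2 hlt
    have := hcl (y k - s) (Finset.mem_insert_of_mem (Finset.mem_image.2
      ⟨(k, s), Finset.mem_product.2 ⟨hk, Finset.mem_Icc.2 ⟨h1, h2⟩⟩, rfl⟩)) (by linarith)
    linarith
  have hz0 : SRel m A M y (glue c E'' y) := by
    refine ⟨fun i hi j hj s h1 h2 => ?_, fun i hi μ hμ => ?_⟩
    · have hs : (1:ℝ) ≤ s := by exact_mod_cast h1
      by_cases hi' : i ∈ E''
      · have hlt := hc i (hE'' hi') j hj s h1 h2
        have hlt2 : c < glue c E'' y j + s := by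
          by_cases hj' : j ∈ E''
          · rw [glue_pos hj']; linarith
          · rw [glue_neg hj']
            have := DE.ge hy hj
            linarith
        rw [glue_pos hi']
        exact ⟨⟨fun _ => hlt2, fun _ => hlt⟩, ⟨fun hx => absurd hx hlt.not_gt,
          fun hx => absurd hx hlt2.not_gt⟩⟩
      · rw [glue_neg hi']
        by_cases hj' : j ∈ E''
        · rw [glue_pos hj', ha j (hE'' hj') i hi s h1 h2, hb j (hE'' hj') i hi s h1 h2]
          refine ⟨⟨hc1 i hi s h1 h2, fun hx => by linarith⟩, ⟨fun hx => by linarith, fun hx => ?_⟩⟩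
          rcases lt_or_gt_of_ne (hne i hi s h1 h2) with hlt | hlt
          · have := hc1 i hi s h1 h2 hlt
            linarith
          · exact hlt
        · rw [glue_neg hj']
          exact ⟨Iff.rfl, Iff.rfl⟩
    · by_cases hi' : i ∈ E''
      · rw [glue_pos hi']
        have q1 := hmk i (hE'' hi') μ hμ
        have q2 := hvM μ hμ
        exact ⟨⟨fun _ => by linarith, fun _ => q1⟩, ⟨fun hx => by linarith, fun hx => by linarith⟩⟩
      · rw [glue_neg hi']
        exact ⟨Iff.rfl, Iff.rfl⟩
  obtain ⟨φ, p1, p2, p3, p4⟩ := exists_phi t M hI c v htc hv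
    (fun μ hμ => hcv.trans (hvM μ hμ)) hvM
  have hS := hz0.trans (SRel_phi (m := m) (A := A) p1 p2 p3 (glue c E'' y))
  refine ⟨_, ⟨fun i hi => ?_, fun i hi => ?_⟩, hS⟩
  · rw [glue_pos hi, p4]
  · obtain ⟨hiA, hi'⟩ := Finset.mem_sdiff.1 hi
    have hge := DE.ge hy hiA
    refine ⟨?_, fun hm => ?_⟩
    · rw [glue_neg hi']
      rw [← p4]
      exact p1 (hcv.trans_le hge)
    · rcases Finset.mem_union.1 hm with hm | hm
      · have := (hS.mark_iff hiA hm).2 rfl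
        exact (DE.dom hv hvM hy i hiA).2 (this ▸ hm)
      · rw [glue_neg hi'] at hm
        obtain ⟨s, h1, h2, h3⟩ := mem_seg.1 hm
        rw [← p4, ← p2] at h3
        have h4 := p1.injective h3
        have := hc1 i hiA s h1 h2 (by linarith)
        linarith

/-- The inclusion-exclusion coefficients. -/
noncomputable def cE (E : Finset ι) : Polynomial ℚ := if E = ∅ then 0 else (-1) ^ (E.card + 1)

lemma sum_cE (U : Finset ι) (hU : U.Nonempty) : ∑ E ∈ U.powerset, cE E = 1 := by
  have h0 : ∑ E ∈ U.powerset, (-1 : Polynomial ℚ) ^ E.card = 0 := by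
    have := Finset.sum_powerset_neg_one_pow_card_of_nonempty hU
    have h2 := congrArg (Int.cast : ℤ → Polynomial ℚ) this
    push_cast at h2
    exact h2
  have : ∀ E : Finset ι, (cE E : Polynomial ℚ) = (if E = ∅ then 1 else 0) - (-1) ^ E.card := by
    intro E
    unfold cE
    split_ifs with h
    · simp [h]
    · ring
  simp only [this, Finset.sum_sub_distrib, h0]
  rw [Finset.sum_ite_eq' _ (∅ : Finset ι)]
  simp

lemma sum_sat (A : Finset ι) (P : Finset ι → Prop) (hex : ∃ E, E.Nonempty ∧ E ⊆ A ∧ P E)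
    (hcl : ∀ E E' E'', E.Nonempty → E'.Nonempty → E ⊆ A → E' ⊆ A → P E → P E' → E''.Nonempty →
      E'' ⊆ E ∪ E' → P E'') :
    ∑ E ∈ A.powerset, ind (P E) (cE E) = 1 := by
  obtain ⟨U, hU, hmax⟩ := Finset.exists_max_image
    (A.powerset.filter (fun E => E.Nonempty ∧ P E)) Finset.card (by
      obtain ⟨E, h1, h2, h3⟩ := hex
      exact ⟨E, Finset.mem_filter.2 ⟨Finset.mem_powerset.2 h2, h1, h3⟩⟩)
  obtain ⟨hUA, hUne, hUP⟩ := Finset.mem_filter.1 hU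
  rw [Finset.mem_powerset] at hUA
  rw [← sum_cE U hUne]
  symm
  have : ∀ E ∈ U.powerset, cE E = ind (P E) (cE E) := by
    intro E hE
    rcases E.eq_empty_or_nonempty with rfl | hne
    · simp [cE, ind]
    · rw [ind_pos]
      exact hcl U U E hUne hUne hUA hUA hUP hUP hne
        ((Finset.mem_powerset.1 hE).trans Finset.subset_union_left)
  rw [Finset.sum_congr rfl this]
  refine Finset.sum_subset (Finset.powerset_mono.2 hUA) ?_
  intro E hE hE'
  rcases E.eq_empty_or_nonempty with rfl | hne
  · simp [cE, ind]
  · rw [ind_neg]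
    intro hP
    rw [Finset.mem_powerset] at hE hE'
    apply hE'
    have h1 := hmax (U ∪ E) (Finset.mem_filter.2 ⟨Finset.mem_powerset.2
      (Finset.union_subset hUA hE), hUne.mono Finset.subset_union_left,
      hcl U E _ hUne hne hUA hE hUP hP (hUne.mono Finset.subset_union_left) le_rfl⟩)
    have h2 := Finset.eq_of_subset_of_card_le (Finset.subset_union_left (s₁ := U) (s₂ := E)) h1
    rw [h2]
    exact Finset.subset_union_right

lemma NN_empty (m : ℕ) (A : Finset ι) (t : ℝ) (M : Finset ℝ) :
    NN m A t M ∅ = cnt (sSet m A M) (wt m A ∅) (Dom A t M) := by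
  unfold NN
  rw [Finset.union_empty]

lemma NN_split (m : ℕ) (A : Finset ι) (t v : ℝ) (M : Finset ℝ) (hI : Inv t M) (hv : t < v)
    (hvM : ∀ μ ∈ M, v < μ) :
    NN m A t M ∅ = cnt (sSet m A M) (wt m A ∅) (DP A t M) +
      (∑ E ∈ A.powerset, cE E * cnt (sSet m A M) (wt m A ∅) (DE m A M v E) +
      ∑ B ∈ A.powerset, e0 B * cnt (sSet m A M) (wt m A ∅) (DB m A M v B)) := by
  rw [NN_empty]
  have main := cnt_ie (sSet m A M) (wt m A ∅)
    (Finset.disjSum ({()} : Finset Unit) (Finset.disjSum A.powerset A.powerset))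
    (Sum.elim (fun _ => 1) (Sum.elim cE e0)) (Dom A t M)
    (Sum.elim (fun _ => DP A t M) (Sum.elim (DE m A M v) (DB m A M v))) ?_ ?_
  · rw [main, Finset.sum_disjSum, Finset.sum_disjSum]
    simp only [Sum.elim_inl, Sum.elim_inr, Finset.sum_singleton, one_mul]
  · rintro (e | E | B) he y hy
    · exact ⟨y, hy.1, SRel.refl y⟩
    · exact ⟨y, DE.dom hv hvM hy, SRel.refl y⟩
    · exact ⟨y, DB.dom hv hvM hy, SRel.refl y⟩
  · intro x hx
    rw [Finset.sum_disjSum, Finset.sum_disjSum]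
    simp only [Sum.elim_inl, Sum.elim_inr, Finset.sum_singleton]
    by_cases hp : x ∈ DP A t M
    · rw [ind_pos ⟨x, hp, SRel.refl x⟩, Finset.sum_eq_zero, Finset.sum_eq_zero]
      · simp
      · intro B hB
        rcases B.eq_empty_or_nonempty with rfl | ⟨b, hb⟩
        · simp [e0, ind]
        · rw [ind_neg]
          rintro ⟨y, hy, hxy⟩
          exact F1 (Finset.mem_powerset.1 hB hb) hvM hp hxy (hy.1 b hb)
      · intro B hB
        rcases B.eq_empty_or_nonempty with rfl | ⟨b, hb⟩
        · simp [cE, ind]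
        · rw [ind_neg]
          rintro ⟨y, hy, hxy⟩
          exact F1 (Finset.mem_powerset.1 hB hb) hvM hp hxy (hy.1 b hb)
    · obtain ⟨B0, hne0, hB0A, z, hxz, hz⟩ := F4 (m := m) hI hv hvM hx hp
      rw [ind_neg, zero_add]
      swap
      · rintro ⟨y, hy, hxy⟩
        obtain ⟨b, hb⟩ := hne0
        have hzv : z b = v := by
          rcases hz with hz | hz
          · exact hz.1 b hb
          · exact hz.1 b hb
        exact F1 (hB0A hb) hvM hy ((SRel.symm hxy).trans hxz) hzv
      rcases hz with hz | hz
      · rw [sum_sat A (fun E => ∃ y ∈ DE m A M v E, (sSet m A M) x y) ⟨B0, hne0, hB0A, z, hz, hxz⟩,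
          Finset.sum_eq_zero, add_zero]
        · intro B hB
          rcases B.eq_empty_or_nonempty with rfl | hne
          · simp [e0, ind]
          · rw [ind_neg]
            rintro ⟨y, hy, hxy⟩
            exact F2 hne0 hB0A hne (Finset.mem_powerset.1 hB) hz hy (hxz.symm.trans hxy)
        · rintro E E' E'' hE _ hEA hEA' ⟨y, hy, hxy⟩ ⟨y', hy', hxy'⟩ _ hsub
          obtain ⟨w, hw1, hw2⟩ := F5 hI hv hvM hE hEA hEA' hsub hy hy' ((SRel.symm hxy).trans hxy')
          exact ⟨w, hw1, SRel.trans hxy hw2⟩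
      · rw [Finset.sum_eq_zero, zero_add, Finset.sum_eq_single B0]
        · rw [ind_pos ⟨z, hz, hxz⟩, e0, if_neg hne0.ne_empty]
        · intro B hB hne
          rcases B.eq_empty_or_nonempty with rfl | hBne
          · simp [e0, ind]
          · rw [ind_neg]
            rintro ⟨y, hy, hxy⟩
            rw [Finset.mem_powerset] at hB
            exact hne ((F3 hne0 hB0A hB hz hy (hxz.symm.trans hxy)).antisymm
              (F3 hBne hB hB0A hy hz ((SRel.symm hxy).trans hxz)))
        · intro h
          exact absurd (Finset.mem_powerset.2 hB0A) h
        · intro E hE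
          rcases E.eq_empty_or_nonempty with rfl | hne
          · simp [cE, ind]
          · rw [ind_neg]
            rintro ⟨y, hy, hxy⟩
            exact F2 hne (Finset.mem_powerset.1 hE) hne0 hB0A hy hz ((SRel.symm hxy).trans hxz)
end Geo4

section Geo5
variable {ι : Type*} [Fintype ι] [DecidableEq ι]

lemma cnt_empty_set {α R : Type*} [CommRing R] (r : Setoid α) (w : α → R) : cnt r w ∅ = 0 := by
  unfold cnt
  simp

lemma cnt_pop (m : ℕ) (A : Finset ι) (t τ : ℝ) (M : Finset ℝ) (hI : Inv t M)
    (hτ : τ ∈ M) (hτm : ∀ μ ∈ M, τ ≤ μ) :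
    cnt (sSet m A M) (wt m A ∅) (DP A t M) = NN m A τ (M.erase τ) ∅ := by
  rw [NN_empty]
  rw [cnt_transport (sSet m A M) (sSet m A (M.erase τ)) (wt m A ∅) (wt m A ∅)
    (wt_congr (Finset.empty_subset _)) (wt_congr (Finset.empty_subset _)) _
    (Dom A τ (M.erase τ)) id 1 ?_ ?_ ?_ ?_, one_mul]
  · intro y hy
    refine ⟨y, ⟨fun i hi => ⟨(hI τ hτ).1.trans (hy i hi).1, fun h => ?_⟩,
      fun i hi => ⟨τ, hτ, (hy i hi).1⟩⟩, SRel.refl y⟩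
    exact (hy i hi).2 (Finset.mem_erase.2 ⟨(hy i hi).1.ne', h⟩)
  · intro y hy z hz
    constructor
    · intro h
      refine ⟨h.1, fun i hi μ hμ => ?_⟩
      by_cases hμτ : μ = τ
      · subst hμτ
        have h1 := (hy i hi).1
        have h2 := (hz i hi).1
        exact ⟨⟨fun h => absurd h h1.not_gt, fun h => absurd h h2.not_gt⟩,
          ⟨fun _ => h2, fun _ => h1⟩⟩
      · exact h.2 i hi μ (Finset.mem_erase.2 ⟨hμτ, hμ⟩)
    · intro h
      exact ⟨h.1, fun i hi μ hμ => h.2 i hi μ (Finset.mem_of_mem_erase hμ)⟩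
  · intro x hx
    refine ⟨x, fun i hi => ⟨?_, fun h => (hx.1 i hi).2 (Finset.mem_of_mem_erase h)⟩, SRel.refl x⟩
    obtain ⟨μ, hμ, h⟩ := hx.2 i hi
    exact (hτm μ hμ).trans_lt h
  · intro y hy
    rw [one_mul, id]

lemma cnt_pop_empty (m : ℕ) (A : Finset ι) (t : ℝ) (hA : A.Nonempty) :
    cnt (sSet m A ∅) (wt m A ∅) (DP A t ∅) = 0 := by
  have : DP A t ∅ = ∅ := by
    ext x
    simp only [Set.mem_empty_iff_false, iff_false]
    intro hx
    obtain ⟨a, ha⟩ := hA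
    obtain ⟨μ, hμ, _⟩ := hx.2 a ha
    simp at hμ
  rw [this, cnt_empty_set]

lemma NN_base (m : ℕ) (t : ℝ) (M L : Finset ℝ) : NN m (∅ : Finset ι) t M L = 1 := by
  have hD : Dom (∅ : Finset ι) t M = Set.univ := by
    ext x; simp [Dom]
  have hall : ∀ x y, sSet m (∅ : Finset ι) (M ∪ L) x y := by
    intro x y
    exact ⟨fun i hi => by simp at hi, fun i hi => by simp at hi⟩
  have hw : ∀ x, wt m (∅ : Finset ι) L x = 1 := by
    intro x
    have : VS m (∅ : Finset ι) L x = ⊥ := by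
      rw [eq_bot_iff]
      intro g hg
      rw [mem_VS] at hg
      rw [Submodule.mem_bot]
      funext i
      exact hg.1 i (by simp)
    rw [wt, this, finrank_bot, pow_zero]
  unfold NN cnt
  rw [hD]
  rw [finsum_eq_single _ (Quotient.mk _ (fun _ => 0))]
  · rw [if_pos ⟨_, Set.mem_univ _, rfl⟩, hw]
  · intro q hq
    exfalso
    apply hq
    induction q using Quotient.inductionOn with
    | h x => exact Quotient.sound (hall _ _)

lemma finrank_DE {m : ℕ} {A E : Finset ι} {v : ℝ} (hEA : E ⊆ A) {y : ι → ℝ}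
    (hy : ∀ i ∈ A \ E, v < y i ∧ y i ∉ seg v m) :
    Module.finrank ℝ (VS m A ∅ (glue v E y)) =
      E.card + Module.finrank ℝ (VS m (A \ E) ∅ y) := by
  let e : VS m A ∅ (glue v E y) ≃ₗ[ℝ] (E → ℝ) × VS m (A \ E) ∅ y :=
    { toFun := fun g => (fun b => g.1 b, ⟨fun i => if i ∈ E then 0 else g.1 i, by
        obtain ⟨g, g1, g2, g3⟩ := g
        refine ⟨fun i hi => ?_, fun i hi j hj s h1 h2 he => ?_, fun i _ h => by simp at h⟩
        · dsimp only
          split_ifs with h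
          · rfl
          · exact g1 i fun hA => hi (Finset.mem_sdiff.2 ⟨hA, h⟩)
        · obtain ⟨hi, hi'⟩ := Finset.mem_sdiff.1 hi
          obtain ⟨hj, hj'⟩ := Finset.mem_sdiff.1 hj
          dsimp only
          rw [if_neg hi', if_neg hj']
          exact g2 i hi j hj s h1 h2 (by rw [glue_neg hi', glue_neg hj', he])⟩)
      invFun := fun p => ⟨fun i => if h : i ∈ E then p.1 ⟨i, h⟩ else p.2.1 i, by
        obtain ⟨h, g, g1, g2, g3⟩ := p
        refine ⟨fun i hi => ?_, fun i hi j hj s h1 h2 he => ?_, fun i _ h => by simp at h⟩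
        · have : i ∉ E := fun h => hi (hEA h)
          dsimp only
          rw [dif_neg this]
          exact g1 i (by simp [hi])
        · have hs : (1:ℝ) ≤ s := by exact_mod_cast h1
          by_cases hi' : i ∈ E
          · exfalso
            rw [glue_pos hi'] at he
            by_cases hj' : j ∈ E
            · rw [glue_pos hj'] at he
              linarith
            · rw [glue_neg hj'] at he
              have := (hy j (Finset.mem_sdiff.2 ⟨hj, hj'⟩)).1
              linarith
          · have hi2 := Finset.mem_sdiff.2 ⟨hi, hi'⟩
            rw [glue_neg hi'] at he
            by_cases hj' : j ∈ E
            · exfalso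
              rw [glue_pos hj'] at he
              exact (hy i hi2).2 (mem_seg.2 ⟨s, h1, h2, he⟩)
            · rw [glue_neg hj'] at he
              dsimp only
              rw [dif_neg hi', dif_neg hj']
              exact g2 i hi2 j (Finset.mem_sdiff.2 ⟨hj, hj'⟩) s h1 h2 he⟩
      map_add' := by
        intro a b
        refine Prod.ext (by funext i; simp) (Subtype.ext ?_)
        funext i
        by_cases h : i ∈ E <;> simp [h]
      map_smul' := by
        intro a b
        refine Prod.ext (by funext i; simp) (Subtype.ext ?_)
        funext i
        by_cases h : i ∈ E <;> simp [h]
      left_inv := by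
        intro g
        refine Subtype.ext ?_
        funext i
        by_cases h : i ∈ E <;> simp [h]
      right_inv := by
        intro p
        refine Prod.ext (by funext i; simp) (Subtype.ext ?_)
        funext i
        by_cases h : i ∈ E
        · have := p.2.2.1 i (by simp [h])
          simp [h, this]
        · simp [h] }
  rw [e.finrank_eq, Module.finrank_prod, Module.finrank_fintype_fun_eq_card, Fintype.card_coe]

lemma finrank_DB {m : ℕ} {A B : Finset ι} {v : ℝ} (hB : B.Nonempty) (hBA : B ⊆ A) {y : ι → ℝ}
    (hy : ∀ i ∈ A \ B, v < y i) (hex : ∃ i ∈ A \ B, y i ∈ seg v m) :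
    Module.finrank ℝ (VS m A ∅ (glue v B y)) =
      1 + Module.finrank ℝ (VS m (A \ B) (seg v m) y) := by
  obtain ⟨b, hb⟩ := hB
  obtain ⟨b1, hb1, hs1⟩ := hex
  obtain ⟨d, d1, d2, hd⟩ := mem_seg.1 hs1
  obtain ⟨hb1A, hb1B⟩ := Finset.mem_sdiff.1 hb1
  have hconst : ∀ g ∈ VS m A ∅ (glue v B y), ∀ i ∈ B, g i = g b := by
    intro g hg i hi
    have e1 := hg.2.1 b1 hb1A i (hBA hi) d d1 d2 (by rw [glue_neg hb1B, glue_pos hi, hd])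
    have e2 := hg.2.1 b1 hb1A b (hBA hb) d d1 d2 (by rw [glue_neg hb1B, glue_pos hb, hd])
    rw [← e1, e2]
  let e : VS m A ∅ (glue v B y) ≃ₗ[ℝ] ℝ × VS m (A \ B) (seg v m) y :=
    { toFun := fun g => (g.1 b, ⟨fun i => if i ∈ A then g.1 i - g.1 b else 0, by
        obtain ⟨g, hg⟩ := g
        have hc := hconst g hg
        obtain ⟨g1, g2, g3⟩ := hg
        refine ⟨fun i hi => ?_, fun i hi j hj s h1 h2 he => ?_, fun i hi h => ?_⟩
        · dsimp only
          split_ifs with h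
          · have : i ∈ B := by
              by_contra hc
              exact hi (Finset.mem_sdiff.2 ⟨h, hc⟩)
            rw [hc i this, sub_self]
          · rfl
        · obtain ⟨hi, hi'⟩ := Finset.mem_sdiff.1 hi
          obtain ⟨hj, hj'⟩ := Finset.mem_sdiff.1 hj
          dsimp only
          rw [if_pos hi, if_pos hj,
            g2 i hi j hj s h1 h2 (by rw [glue_neg hi', glue_neg hj', he])]
        · obtain ⟨hi, hi'⟩ := Finset.mem_sdiff.1 hi
          obtain ⟨s, h1, h2, he⟩ := mem_seg.1 h
          dsimp only
          rw [if_pos hi, g2 i hi b (hBA hb) s h1 h2 (by rw [glue_neg hi', glue_pos hb, he]),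
            sub_self]⟩)
      invFun := fun p => ⟨fun i => if i ∈ A then p.2.1 i + p.1 else 0, by
        obtain ⟨c, g, g1, g2, g3⟩ := p
        refine ⟨fun i hi => ?_, fun i hi j hj s h1 h2 he => ?_, fun i _ h => by simp at h⟩
        · dsimp only
          rw [if_neg hi]
        · have hs : (1:ℝ) ≤ s := by exact_mod_cast h1
          dsimp only
          rw [if_pos hi, if_pos hj]
          congr 1
          by_cases hi' : i ∈ B
          · exfalso
            rw [glue_pos hi'] at he
            by_cases hj' : j ∈ B
            · rw [glue_pos hj'] at he
              linarith
            · rw [glue_neg hj'] at he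
              have := hy j (Finset.mem_sdiff.2 ⟨hj, hj'⟩)
              linarith
          · have hi2 := Finset.mem_sdiff.2 ⟨hi, hi'⟩
            rw [glue_neg hi'] at he
            by_cases hj' : j ∈ B
            · rw [glue_pos hj'] at he
              rw [g3 i hi2 (mem_seg.2 ⟨s, h1, h2, he⟩), g1 j (by simp [hj'])]
            · rw [glue_neg hj'] at he
              exact g2 i hi2 j (Finset.mem_sdiff.2 ⟨hj, hj'⟩) s h1 h2 he⟩
      map_add' := by
        intro a b
        refine Prod.ext (by simp) (Subtype.ext ?_)
        funext i
        by_cases h : i ∈ A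
        · simp [h]; ring
        · simp [h]
      map_smul' := by
        intro a b
        refine Prod.ext (by simp) (Subtype.ext ?_)
        funext i
        by_cases h : i ∈ A
        · simp [h]; ring
        · simp [h]
      left_inv := by
        intro g
        refine Subtype.ext ?_
        funext i
        by_cases h : i ∈ A
        · simp [h]
        · simp [h, g.2.1 i h]
      right_inv := by
        intro p
        have hb0 := p.2.2.1 b (by simp [hb])
        refine Prod.ext (by simp [hBA hb, hb0]) (Subtype.ext ?_)
        funext i
        by_cases h : i ∈ A
        · simp [h, hBA hb, hb0]
        · have := p.2.2.1 i (by simp [h])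
          simp [h, this] }
  rw [e.finrank_eq, Module.finrank_prod, Module.finrank_self]

lemma glue_step_iff {m : ℕ} {A B : Finset ι} {v : ℝ} {M : Finset ℝ} (hB : B.Nonempty)
    (hBA : B ⊆ A) {y z : ι → ℝ} (hy : ∀ i ∈ A \ B, v < y i) (hz : ∀ i ∈ A \ B, v < z i) :
    SRel m (A \ B) (M ∪ seg v m) y z ↔ SRel m A M (glue v B y) (glue v B z) := by
  refine SRel_glue (t := v) hB hBA ?_ ?_ Finset.subset_union_left le_rfl hy hz
  · intro s h1 h2
    exact Finset.mem_union_right _ (mem_seg.2 ⟨s, h1, h2, rfl⟩)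
  · intro s h1 h2
    right
    have : (0:ℝ) ≤ s := Nat.cast_nonneg s
    linarith

lemma cnt_DE (m : ℕ) (A E : Finset ι) (v : ℝ) (M : Finset ℝ) (hE : E.Nonempty) (hEA : E ⊆ A) :
    cnt (sSet m A M) (wt m A ∅) (DE m A M v E) =
      Polynomial.X ^ E.card * NN m (A \ E) v (M ∪ seg v m) ∅ := by
  rw [NN_empty]
  refine cnt_transport (sSet m A M) (sSet m (A \ E) (M ∪ seg v m)) (wt m A ∅) (wt m (A \ E) ∅)
    (wt_congr (Finset.empty_subset _)) (wt_congr (Finset.empty_subset _)) _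
    _ (glue v E) _ ?_ ?_ ?_ ?_
  · intro y hy
    refine ⟨_, ⟨fun i hi => glue_pos hi, fun i hi => ?_⟩, SRel.refl _⟩
    rw [glue_neg (Finset.mem_sdiff.1 hi).2]
    exact hy i hi
  · intro y hy z hz
    exact glue_step_iff hE hEA (fun i hi => (hy i hi).1) (fun i hi => (hz i hi).1)
  · intro x hx
    refine ⟨x, hx.2, ?_⟩
    rw [glue_self hx.1]
  · intro y hy
    rw [wt, wt, finrank_DE hEA, pow_add]
    exact fun i hi => ⟨(hy i hi).1, fun h => (hy i hi).2 (Finset.mem_union_right _ h)⟩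

lemma cnt_split (m : ℕ) (A : Finset ι) (v : ℝ) (M L : Finset ℝ) :
    cnt (sSet m A (M ∪ L)) (wt m A L) {x | x ∈ Dom A v M ∧ ∃ i ∈ A, x i ∈ L} =
      NN m A v M L - NN m A v (M ∪ L) ∅ := by
  rw [eq_sub_iff_add_eq, ← cnt_complete]
  have main := cnt_ie (sSet m A (M ∪ L)) (wt m A L) (Finset.univ : Finset Bool) (fun _ => 1)
    (Dom A v M) (fun b => if b = true then {x | x ∈ Dom A v M ∧ ∃ i ∈ A, x i ∈ L} else
      {x | x ∈ Dom A v M ∧ ∀ i ∈ A, x i ∉ L}) ?_ ?_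
  · change NN m A v M L = _ at main
    rw [main]
    simp
  · rintro (_ | _) _ y hy
    · exact ⟨y, hy.1, SRel.refl y⟩
    · exact ⟨y, hy.1, SRel.refl y⟩
  · intro x hx
    rw [Fintype.sum_bool]
    by_cases hc : ∃ i ∈ A, x i ∈ L
    · rw [ind_pos ⟨x, ⟨hx, hc⟩, SRel.refl x⟩, ind_neg, add_zero]
      rintro ⟨y, hy, hxy⟩
      obtain ⟨i, hi, h⟩ := hc
      refine hy.2 i hi ?_
      rwa [(SRel.mark_iff hxy hi (Finset.mem_union_right _ h)).1 rfl]
    · rw [ind_neg, zero_add, ind_pos]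
      · refine ⟨x, ⟨hx, ?_⟩, SRel.refl x⟩
        push Not at hc
        exact hc
      · rintro ⟨y, hy, hxy⟩
        obtain ⟨i, hi, h⟩ := hy.2
        refine hc ⟨i, hi, ?_⟩
        rwa [(SRel.mark_iff hxy hi (Finset.mem_union_right _ h)).2 rfl]

lemma cnt_DB (m : ℕ) (A B : Finset ι) (v : ℝ) (M : Finset ℝ) (hB : B.Nonempty) (hBA : B ⊆ A) :
    cnt (sSet m A M) (wt m A ∅) (DB m A M v B) =
      Polynomial.X * (NN m (A \ B) v M (seg v m) - NN m (A \ B) v (M ∪ seg v m) ∅) := by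
  rw [← cnt_split]
  refine cnt_transport (sSet m A M) (sSet m (A \ B) (M ∪ seg v m)) (wt m A ∅)
    (wt m (A \ B) (seg v m))
    (wt_congr (Finset.empty_subset _)) (wt_congr Finset.subset_union_right) _
    _ (glue v B) _ ?_ ?_ ?_ ?_
  · intro y hy
    refine ⟨_, ⟨fun i hi => glue_pos hi, fun i hi => ?_, ?_⟩, SRel.refl _⟩
    · rw [glue_neg (Finset.mem_sdiff.1 hi).2]
      exact hy.1 i hi
    · obtain ⟨i, hi, h⟩ := hy.2
      refine ⟨i, hi, ?_⟩
      rwa [glue_neg (Finset.mem_sdiff.1 hi).2]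
  · intro y hy z hz
    exact glue_step_iff hB hBA (fun i hi => (hy.1 i hi).1) (fun i hi => (hz.1 i hi).1)
  · intro x hx
    refine ⟨x, ⟨hx.2.1, hx.2.2⟩, ?_⟩
    rw [glue_self hx.1]
  · intro y hy
    rw [wt, wt, finrank_DB hB hBA (fun i hi => (hy.1 i hi).1) hy.2, pow_add, pow_one]

lemma NN_closed (m : ℕ) (A : Finset ι) (t v : ℝ) (M : Finset ℝ) (hI : Inv t M) (hv : t < v)
    (hvM : ∀ μ ∈ M, v < μ) :
    NN m A t M ∅ = cnt (sSet m A M) (wt m A ∅) (DP A t M) +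
      (∑ E ∈ A.powerset, cE E * (Polynomial.X ^ E.card * NN m (A \ E) v (M ∪ seg v m) ∅) +
      ∑ B ∈ A.powerset, e0 B * (Polynomial.X *
        (NN m (A \ B) v M (seg v m) - NN m (A \ B) v (M ∪ seg v m) ∅))) := by
  rw [NN_split m A t v M hI hv hvM]
  congr 2
  · refine Finset.sum_congr rfl fun E hE => ?_
    rcases E.eq_empty_or_nonempty with rfl | hne
    · simp [cE]
    · rw [cnt_DE m A E v M hne (Finset.mem_powerset.1 hE)]
  · refine Finset.sum_congr rfl fun E hE => ?_
    rcases E.eq_empty_or_nonempty with rfl | hne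
    · simp [e0]
    · rw [cnt_DB m A E v M hne (Finset.mem_powerset.1 hE)]
end Geo5

section Alg

/-- Normalized coefficients. -/
noncomputable def aa (G : PowerSeries (Polynomial ℚ)) (n : ℕ) : Polynomial ℚ :=
  (n.factorial : Polynomial ℚ) * PowerSeries.coeff n G

lemma aa_add (F G : PowerSeries (Polynomial ℚ)) (n : ℕ) : aa (F + G) n = aa F n + aa G n := by
  simp [aa, mul_add]

lemma aa_sub (F G : PowerSeries (Polynomial ℚ)) (n : ℕ) : aa (F - G) n = aa F n - aa G n := by
  simp [aa, mul_sub]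

lemma aa_sum {I : Type*} (s : Finset I) (F : I → PowerSeries (Polynomial ℚ)) (n : ℕ) :
    aa (∑ i ∈ s, F i) n = ∑ i ∈ s, aa (F i) n := by
  simp [aa, Finset.mul_sum]

lemma aa_U (F : PowerSeries (Polynomial ℚ)) (n : ℕ) :
    aa (Useries * F) n = Polynomial.X * aa F n := by
  simp only [aa, Useries, PowerSeries.coeff_C_mul]
  ring

lemma aa_mul {ι : Type*} [DecidableEq ι] (F G : PowerSeries (Polynomial ℚ)) (A : Finset ι) :
    aa (F * G) A.card = ∑ B ∈ A.powerset, aa F B.card * aa G (A \ B).card := by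
  have h1 : ∀ B ∈ A.powerset, aa F B.card * aa G (A \ B).card =
      (fun k => aa F k * aa G (A.card - k)) B.card := by
    intro B hB
    rw [Finset.card_sdiff_of_subset (Finset.mem_powerset.1 hB)]
  rw [Finset.sum_congr rfl h1, Finset.sum_powerset_apply_card (fun k => aa F k * aa G (A.card - k))]
  rw [aa, PowerSeries.coeff_mul, Finset.Nat.sum_antidiagonal_eq_sum_range_succ
    (fun i j => PowerSeries.coeff i F * PowerSeries.coeff j G), Finset.mul_sum]
  refine Finset.sum_congr rfl fun k hk => ?_
  have hk' : k ≤ A.card := by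
    have := Finset.mem_range.1 hk
    omega
  have := Nat.choose_mul_factorial_mul_factorial hk'
  rw [← this, nsmul_eq_mul]
  simp only [aa]
  push_cast
  ring

lemma cast_fact_mul (n : ℕ) : (n.factorial : Polynomial ℚ) * Polynomial.C ((n.factorial : ℚ)⁻¹) = 1 := by
  have : (n.factorial : Polynomial ℚ) = Polynomial.C (n.factorial : ℚ) := by simp
  rw [this, ← Polynomial.C_mul, mul_inv_cancel₀ (by exact_mod_cast n.factorial_ne_zero),
    Polynomial.C_1]

lemma aa_one (n : ℕ) : aa 1 n = if n = 0 then 1 else 0 := by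
  unfold aa
  rw [PowerSeries.coeff_one]
  split_ifs with h
  · simp [h]
  · simp

lemma aa_X (n : ℕ) : aa (Eexp - 1) n = if n = 0 then 0 else 1 := by
  rw [aa_sub, aa_one, aa, Eexp, PowerSeries.coeff_mk, cast_fact_mul]
  split_ifs <;> simp

lemma aa_E (n : ℕ) :
    aa (1 - EexuNeg) n = if n = 0 then 0 else (-1) ^ (n + 1) * Polynomial.X ^ n := by
  have : aa EexuNeg n = (-1) ^ n * Polynomial.X ^ n := by
    rw [aa, EexuNeg, PowerSeries.coeff_mk, Polynomial.smul_eq_C_mul, Polynomial.C_mul]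
    calc _ = Polynomial.C ((-1:ℚ) ^ n) * ((n.factorial : Polynomial ℚ) *
          Polynomial.C ((n.factorial : ℚ)⁻¹)) * Polynomial.X ^ n := by ring
      _ = _ := by rw [cast_fact_mul]; simp
  rw [aa_sub, this, aa_one]
  split_ifs with h
  · simp [h]
  · ring

/-- The map whose fixed point is sought. -/
noncomputable def Phi (m : ℕ) (H : PowerSeries (Polynomial ℚ)) : PowerSeries (Polynomial ℚ) :=
  1 + (1 - EexuNeg) * H ^ (m + 1) + Useries * OmTilde m H

lemma cc_Eexp : PowerSeries.constantCoeff (Eexp - 1) = 0 := by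
  simp [Eexp]

lemma cc_EexuNeg : PowerSeries.constantCoeff (1 - EexuNeg) = 0 := by
  simp [EexuNeg]

/-- The denominator. -/
noncomputable def WW (m : ℕ) (Y : PowerSeries (Polynomial ℚ)) : PowerSeries (Polynomial ℚ) :=
  1 - (Eexp - 1) * ∑ p ∈ Finset.range m, Y ^ (p + 1)

/-- The inverse of the denominator. -/
noncomputable def VV (m : ℕ) (Y : PowerSeries (Polynomial ℚ)) : PowerSeries (Polynomial ℚ) :=
  PowerSeries.invOfUnit (1 - (Eexp - 1) * ∑ p ∈ Finset.range m, Y ^ (p + 1)) 1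

lemma WW_VV (m : ℕ) (Y : PowerSeries (Polynomial ℚ)) : WW m Y * VV m Y = 1 := by
  apply PowerSeries.mul_invOfUnit
  rw [WW, map_sub, map_mul, cc_Eexp]
  simp

lemma OmTilde_eq (m : ℕ) (Y : PowerSeries (Polynomial ℚ)) :
    OmTilde m Y = (Eexp - 1) ^ 2 * Y ^ (m + 2) * (∑ p ∈ Finset.range m, Y ^ p) * VV m Y := rfl

lemma Phi_contract (m n : ℕ) (H H' : PowerSeries (Polynomial ℚ))
    (h : (PowerSeries.X : PowerSeries (Polynomial ℚ)) ^ n ∣ H - H') :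
    (PowerSeries.X : PowerSeries (Polynomial ℚ)) ^ (n + 1) ∣ Phi m H - Phi m H' := by
  obtain ⟨g, hg⟩ := PowerSeries.X_dvd_iff.2 cc_Eexp
  obtain ⟨g', hg'⟩ := PowerSeries.X_dvd_iff.2 cc_EexuNeg
  let q := Ideal.Quotient.mk (Ideal.span {(PowerSeries.X : PowerSeries (Polynomial ℚ)) ^ n})
  have hq : q H = q H' := by
    rw [Ideal.Quotient.mk_eq_mk_iff_sub_mem, Ideal.mem_span_singleton]
    exact h
  have hW : q (WW m H) = q (WW m H') := by
    simp only [WW, map_sub, map_mul, map_sum, map_pow, hq, map_one]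
  have hV : q (VV m H) = q (VV m H') := by
    have e1 : q (WW m H) * q (VV m H) = 1 := by rw [← map_mul, WW_VV, map_one]
    have e2 : q (WW m H') * q (VV m H') = 1 := by rw [← map_mul, WW_VV, map_one]
    calc q (VV m H) = q (VV m H) * (q (WW m H') * q (VV m H')) := by rw [e2, mul_one]
      _ = (q (WW m H) * q (VV m H)) * q (VV m H') := by rw [hW]; ring
      _ = _ := by rw [e1, one_mul]
  let G : PowerSeries (Polynomial ℚ) → PowerSeries (Polynomial ℚ) := fun Y =>
    g' * Y ^ (m + 1) + Useries * ((Eexp - 1) * g * Y ^ (m + 2) *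
      (∑ p ∈ Finset.range m, Y ^ p) * VV m Y)
  have hPhi : ∀ Y, Phi m Y = 1 + PowerSeries.X * G Y := by
    intro Y
    simp only [Phi, OmTilde_eq, G]
    have : (Eexp - 1) ^ 2 = (Eexp - 1) * (PowerSeries.X * g) := by rw [← hg, sq]
    rw [this, hg']
    ring
  have hG : q (G H) = q (G H') := by
    simp only [G, map_add, map_mul, map_sum, map_pow, hq, hV]
  rw [Ideal.Quotient.mk_eq_mk_iff_sub_mem, Ideal.mem_span_singleton] at hG
  have : Phi m H - Phi m H' = PowerSeries.X * (G H - G H') := by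
    rw [hPhi, hPhi]; ring
  rw [this, pow_succ']
  exact mul_dvd_mul_left _ hG

lemma eq_of_X_pow_dvd (H H' : PowerSeries (Polynomial ℚ))
    (h : ∀ n, (PowerSeries.X : PowerSeries (Polynomial ℚ)) ^ n ∣ H - H') : H = H' := by
  ext1 n
  have := PowerSeries.X_pow_dvd_iff.1 (h (n + 1)) n (Nat.lt_succ_self n)
  rw [map_sub] at this
  exact sub_eq_zero.1 this

lemma Phi_unique (m : ℕ) (H H' : PowerSeries (Polynomial ℚ)) (h : H = Phi m H)
    (h' : H' = Phi m H') : H = H' := by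
  apply eq_of_X_pow_dvd
  intro n
  induction n with
  | zero => simp
  | succ n ih =>
    rw [h, h']
    exact Phi_contract m n H H' ih

lemma Phi_exists (m : ℕ) : ∃ H, H = Phi m H := by
  let a : ℕ → PowerSeries (Polynomial ℚ) := fun n => (Phi m)^[n] 1
  have ha : ∀ n, a (n + 1) = Phi m (a n) := fun n => Function.iterate_succ_apply' _ _ _
  have h1 : ∀ n, (PowerSeries.X : PowerSeries (Polynomial ℚ)) ^ n ∣ a (n + 1) - a n := by
    intro n
    induction n with
    | zero => simp
    | succ n ih =>
      rw [ha (n + 1)]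
      conv_rhs => rw [ha n]
      rw [← ha n] 
      have := Phi_contract m n _ _ ih
      rwa [← ha n] at this
  have h2 : ∀ k j, PowerSeries.coeff k (a (k + 1 + j)) = PowerSeries.coeff k (a (k + 1)) := by
    intro k j
    induction j with
    | zero => rfl
    | succ j ih =>
      rw [← ih]
      have := PowerSeries.X_pow_dvd_iff.1 (h1 (k + 1 + j)) k (by omega)
      rw [map_sub] at this
      exact sub_eq_zero.1 this
  let H : PowerSeries (Polynomial ℚ) := PowerSeries.mk fun n => PowerSeries.coeff n (a (n + 1))
  have h3 : ∀ n, (PowerSeries.X : PowerSeries (Polynomial ℚ)) ^ n ∣ H - a n := by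
    intro n
    rw [PowerSeries.X_pow_dvd_iff]
    intro k hk
    obtain ⟨j, rfl⟩ : ∃ j, n = k + 1 + j := ⟨n - (k + 1), by omega⟩
    rw [map_sub, h2, PowerSeries.coeff_mk, sub_self]
  refine ⟨H, eq_of_X_pow_dvd _ _ fun n => ?_⟩
  have e1 := h3 (n + 1)
  have e2 := Phi_contract m n _ _ (h3 n)
  rw [← ha] at e2
  have := dvd_sub e1 e2
  refine (pow_dvd_pow _ (Nat.le_succ n)).trans ?_
  convert this using 1
  ring

lemma cc_Phi (m : ℕ) (H : PowerSeries (Polynomial ℚ)) (h : H = Phi m H) :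
    PowerSeries.constantCoeff H = 1 := by
  rw [h, Phi, OmTilde]
  rw [map_add, map_add, map_mul, map_mul, map_mul, map_mul, map_mul, map_pow (PowerSeries.constantCoeff) (Eexp - 1), cc_Eexp, cc_EexuNeg]
  simp

lemma cc_VV (m : ℕ) (H : PowerSeries (Polynomial ℚ)) :
    PowerSeries.constantCoeff (VV m H) = 1 := by
  rw [VV, PowerSeries.constantCoeff_invOfUnit]
  simp

lemma VV_eq (m : ℕ) (H : PowerSeries (Polynomial ℚ)) :
    VV m H = 1 + (Eexp - 1) * (∑ p ∈ Finset.range m, H ^ (p + 1)) * VV m H := by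
  have := WW_VV m H
  rw [WW] at this
  linear_combination this

lemma T_eq (m h : ℕ) (H : PowerSeries (Polynomial ℚ)) :
    H ^ (h + m + 1) * VV m H = H ^ (h + m + 1) +
      ∑ d ∈ Finset.Icc 1 m, (Eexp - 1) * (H ^ (h + d + m + 1) * VV m H) := by
  have e : ∑ d ∈ Finset.Icc 1 m, (Eexp - 1) * (H ^ (h + d + m + 1) * VV m H) =
      H ^ (h + m + 1) * ((Eexp - 1) * (∑ p ∈ Finset.range m, H ^ (p + 1)) * VV m H) := by
    rw [← Finset.Ico_add_one_right_eq_Icc, Finset.sum_Ico_eq_sum_range, Finset.mul_sum, Finset.sum_mul, Finset.mul_sum]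
    refine Finset.sum_congr (by simp) fun p _ => ?_
    ring
  rw [e]
  conv_lhs => rw [VV_eq]
  ring

lemma P_eq (m h : ℕ) (H : PowerSeries (Polynomial ℚ)) (hH : H = Phi m H) :
    H ^ (h + 1) = H ^ h + ((1 - EexuNeg) * H ^ (h + m + 1) +
      (Eexp - 1) * (Useries * (H ^ (h + m + 1) * VV m H - H ^ (h + m + 1)))) := by
  have e : H ^ (h + m + 1) * VV m H - H ^ (h + m + 1) =
      H ^ (h + m + 1) * ((Eexp - 1) * (∑ p ∈ Finset.range m, H ^ (p + 1)) * VV m H) := by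
    conv_lhs => rw [VV_eq]
    ring
  have e2 : ∑ p ∈ Finset.range m, H ^ (p + 1) = H * ∑ p ∈ Finset.range m, H ^ p := by
    rw [Finset.mul_sum]
    exact Finset.sum_congr rfl fun p _ => by ring
  rw [e, e2]
  have e3 : H ^ (h + 1) = H ^ h * Phi m H := by rw [← hH, pow_succ]
  rw [e3, Phi, OmTilde_eq]
  ring

lemma aa_zero_of_cc (G : PowerSeries (Polynomial ℚ)) (h : PowerSeries.constantCoeff G = 1) :
    aa G 0 = 1 := by
  simp [aa, h]

end Alg

section Ind
variable {ι : Type*} [Fintype ι] [DecidableEq ι]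

lemma NN_formula (m : ℕ) (H : PowerSeries (Polynomial ℚ)) (hH : H = Phi m H) (n : ℕ) :
    ∀ A : Finset ι, A.card = n →
      (∀ t M, Inv t M → NN m A t M ∅ = aa (H ^ (M.card + 1)) A.card) ∧
      (∀ t M a, JJ t M a → NN m A t M (seg a m) = aa (H ^ (M.card + m + 1) * VV m H) A.card) := by
  have hcc := cc_Phi m H hH
  induction n using Nat.strong_induction_on with
  | _ n ih =>
  intro A hA
  rcases A.eq_empty_or_nonempty with rfl | hne
  · refine ⟨fun t M _ => ?_, fun t M a _ => ?_⟩
    · rw [NN_base, Finset.card_empty, aa_zero_of_cc]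
      simp [hcc]
    · rw [NN_base, Finset.card_empty, aa_zero_of_cc]
      simp [hcc, cc_VV]
  have ih1 : ∀ B ⊆ A, B.Nonempty → ∀ t M, Inv t M →
      NN m (A \ B) t M ∅ = aa (H ^ (M.card + 1)) (A \ B).card := by
    intro B hB hBne t M hI
    refine (ih _ ?_ (A \ B) rfl).1 t M hI
    rw [← hA]
    exact Finset.card_lt_card (Finset.sdiff_ssubset hB hBne)
  have ih2 : ∀ B ⊆ A, B.Nonempty → ∀ t M a, JJ t M a →
      NN m (A \ B) t M (seg a m) = aa (H ^ (M.card + m + 1) * VV m H) (A \ B).card := by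
    intro B hB hBne t M a hI
    refine (ih _ ?_ (A \ B) rfl).2 t M a hI
    rw [← hA]
    exact Finset.card_lt_card (Finset.sdiff_ssubset hB hBne)
  have step : ∀ t M, Inv t M →
      cnt (sSet m A M) (wt m A ∅) (DP A t M) = aa (H ^ M.card) A.card →
      NN m A t M ∅ = aa (H ^ (M.card + 1)) A.card := by
    intro t M hI hpop
    obtain ⟨v, hv, hvM⟩ := hI.exists_v
    have hJ : JJ v M v := by
      have := hI.JJ_seg hv hvM 0
      simpa [seg] using this
    rw [NN_closed m A t v M hI hv hvM, hpop, P_eq m M.card H hH, aa_add, aa_add, aa_mul, aa_mul]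
    congr 2
    · refine Finset.sum_congr rfl fun B hB => ?_
      rcases B.eq_empty_or_nonempty with rfl | hBne
      · simp [cE, aa_E]
      · rw [ih1 B (Finset.mem_powerset.1 hB) hBne _ _ (hI.insert_seg hv hvM m),
          hI.card hv hvM, cE, aa_E, if_neg hBne.ne_empty, if_neg hBne.card_pos.ne', mul_assoc]
    · refine Finset.sum_congr rfl fun B hB => ?_
      rcases B.eq_empty_or_nonempty with rfl | hBne
      · simp [e0, aa_X]
      · rw [ih1 B (Finset.mem_powerset.1 hB) hBne _ _ (hI.insert_seg hv hvM m),
          ih2 B (Finset.mem_powerset.1 hB) hBne _ _ _ hJ,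
          hI.card hv hvM, e0, aa_X, if_neg hBne.ne_empty, if_neg hBne.card_pos.ne', aa_U, aa_sub]
  have closed : ∀ k : ℕ, ∀ t M, M.card = k → Inv t M →
      NN m A t M ∅ = aa (H ^ (M.card + 1)) A.card := by
    intro k
    induction k with
    | zero =>
      intro t M hM hI
      apply step t M hI
      rw [Finset.card_eq_zero.1 hM, cnt_pop_empty m A t hne, Finset.card_empty, pow_zero, aa_one,
        if_neg hne.card_pos.ne']
    | succ k ihk =>
      intro t M hM hI
      apply step t M hI
      have hMne : M.Nonempty := Finset.card_pos.1 (by omega)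
      have hτ := M.min'_mem hMne
      have hτm : ∀ μ ∈ M, M.min' hMne ≤ μ := fun μ h => M.min'_le μ h
      have hc : (M.erase (M.min' hMne)).card = k := by
        rw [Finset.card_erase_of_mem hτ]; omega
      rw [cnt_pop m A t _ M hI hτ hτm, ihk _ _ hc (hI.pop hτ hτm), hc, hM]
  refine ⟨fun t M hI => closed _ t M rfl hI, fun t M a hJ => ?_⟩
  rw [NN_open m A t a M hJ, closed _ _ _ rfl (hJ.Inv_seg m), hJ.card, T_eq, aa_add, aa_sum]
  congr 1
  refine Finset.sum_congr rfl fun d _ => ?_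
  rw [aa_mul]
  refine Finset.sum_congr rfl fun B hB => ?_
  rcases B.eq_empty_or_nonempty with rfl | hBne
  · simp [e0, aa_X]
  · rw [ih2 B (Finset.mem_powerset.1 hB) hBne _ _ _ (hJ.seg d), hJ.card, e0, aa_X,
      if_neg hBne.ne_empty, if_neg hBne.card_pos.ne']
end Ind

section Face

/-- The index set of the arrangement. -/
def SS (m : ℕ) : Set ℤ := {s : ℤ | s.natAbs ≤ m ∧ s ≠ 0}

/-- Same side. -/
def Sm (a b s : ℝ) : Prop := (a < s ↔ b < s) ∧ (s < a ↔ s < b)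

lemma SRel_iff (m n : ℕ) (x y : Fin n → ℝ) : SRel m Finset.univ ∅ x y ↔
    ∀ i j : Fin n, i < j → ∀ s : ℤ, s ∈ SS m → Sm (x i - x j) (y i - y j) s := by
  constructor
  · intro h i j _ s hs
    obtain ⟨hs1, hs2⟩ := hs
    rcases lt_or_gt_of_ne hs2 with h0 | h0
    · obtain ⟨a, b⟩ := h.1 j (Finset.mem_univ _) i (Finset.mem_univ _) s.natAbs (by omega) hs1
      have e : (s : ℝ) = -(s.natAbs : ℝ) := by
        have : s = -(s.natAbs : ℤ) := by omega
        rw [this]; push_cast; simp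
      rw [e]
      constructor
      · constructor
        · intro h'; have := b.1 (by linarith); linarith
        · intro h'; have := b.2 (by linarith); linarith
      · constructor
        · intro h'; have := a.1 (by linarith); linarith
        · intro h'; have := a.2 (by linarith); linarith
    · obtain ⟨a, b⟩ := h.1 i (Finset.mem_univ _) j (Finset.mem_univ _) s.natAbs (by omega) hs1
      have e : (s : ℝ) = (s.natAbs : ℝ) := by
        have : s = (s.natAbs : ℤ) := by omega
        rw [this]; push_cast; simp
      rw [e]
      constructor
      · constructor
        · intro h'; have := a.1 (by linarith); linarith
        · intro h'; have := a.2 (by linarith); linarith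
      · constructor
        · intro h'; have := b.1 (by linarith); linarith
        · intro h'; have := b.2 (by linarith); linarith
  · intro h
    refine ⟨fun i _ j _ s h1 h2 => ?_, fun i _ μ hμ => by simp at hμ⟩
    rcases lt_trichotomy i j with hij | rfl | hij
    · obtain ⟨a, b⟩ := h i j hij (s : ℤ) ⟨by simpa using h2, by omega⟩
      push_cast at a b
      constructor
      · constructor
        · intro h'; have := a.1 (by linarith); linarith
        · intro h'; have := a.2 (by linarith); linarith
      · constructor
        · intro h'; have := b.1 (by linarith); linarith
        · intro h'; have := b.2 (by linarith); linarith
    · simp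
    · obtain ⟨a, b⟩ := h j i hij (-s : ℤ) ⟨by simpa using h2, by omega⟩
      push_cast at a b
      constructor
      · constructor
        · intro h'; have := b.1 (by linarith); linarith
        · intro h'; have := b.2 (by linarith); linarith
      · constructor
        · intro h'; have := a.1 (by linarith); linarith
        · intro h'; have := a.2 (by linarith); linarith

lemma hyp_inj {n : ℕ} {i j i' j' : Fin n} {s s' : ℝ} (hij : i ≠ j)
    (h : hyp n i j s = hyp n i' j' s') :
    (i' = i ∧ j' = j ∧ s' = s) ∨ (i' = j ∧ j' = i ∧ s' = -s) := by
  have key : ∀ x : Fin n → ℝ, x i - x j = s ↔ x i' - x j' = s' := fun x => by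
    have := Set.ext_iff.1 h x
    exact this
  have hp : (Pi.single i s : Fin n → ℝ) i' - (Pi.single i s : Fin n → ℝ) j' = s' := by
    rw [← key]; simp [hij.symm]
  have hne : i' ≠ j' := by
    rintro rfl
    rw [sub_self] at hp
    have := (key (Pi.single i (s + 1))).2 (by rw [sub_self]; exact hp)
    simp [hij.symm] at this
  have hk : ∀ k, k ≠ i → k ≠ j → k ≠ i' ∧ k ≠ j' := by
    intro k hki hkj
    have hq := (key (Pi.single i s + Pi.single k 1)).1 (by simp [hij.symm, hki.symm, hkj.symm])
    simp only [Pi.add_apply] at hq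
    constructor
    · rintro rfl
      simp only [Pi.single_eq_same, Pi.single_eq_of_ne (Ne.symm hne)] at hq
      linarith
    · rintro rfl
      simp only [Pi.single_eq_same, Pi.single_eq_of_ne hne] at hq
      linarith
  have hi' : i' = i ∨ i' = j := by
    by_contra hc
    push Not at hc
    exact (hk i' hc.1 hc.2).1 rfl
  have hj' : j' = i ∨ j' = j := by
    by_contra hc
    push Not at hc
    exact (hk j' hc.1 hc.2).2 rfl
  rcases hi' with rfl | rfl <;> rcases hj' with rfl | rfl
  · exact absurd rfl hne
  · left
    simp [hij.symm] at hp
    exact ⟨rfl, rfl, hp.symm⟩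
  · right
    simp [hij.symm] at hp
    exact ⟨rfl, rfl, hp.symm⟩
  · exact absurd rfl hne

lemma side_cases {n : ℕ} {i j : Fin n} {s : ℝ} (hij : i ≠ j) {σ : Set (Fin n → ℝ)}
    (h : IsSideOf n σ (hyp n i j s)) :
    σ = {x | x i - x j = s} ∨ σ = {x | x i - x j < s} ∨ σ = {x | s < x i - x j} := by
  rcases h with h | ⟨i', j', s', h1, h2⟩
  · left; exact h
  · right
    rcases hyp_inj hij h1 with ⟨rfl, rfl, rfl⟩ | ⟨rfl, rfl, rfl⟩
    · exact h2
    · rcases h2 with h2 | h2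
      · right
        rw [h2]; ext x
        change x i' - x j' < -s ↔ s < x j' - x i'
        constructor <;> intro h <;> linarith
      · left
        rw [h2]; ext x
        change -s < x i' - x j' ↔ x j' - x i' < s
        constructor <;> intro h <;> linarith

lemma side_mem {n : ℕ} {i j : Fin n} {s : ℝ} (hij : i ≠ j) {σ : Set (Fin n → ℝ)}
    (h : IsSideOf n σ (hyp n i j s)) {x : Fin n → ℝ} (hx : x ∈ σ) (y : Fin n → ℝ) :
    y ∈ σ ↔ Sm (x i - x j) (y i - y j) s := by
  unfold Sm
  rcases side_cases hij h with rfl | rfl | rfl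
  · change x i - x j = s at hx
    change y i - y j = s ↔ _
    rw [hx]
    simp only [lt_irrefl, false_iff, not_lt]
    exact ⟨fun h => ⟨h.ge, h.le⟩, fun h => le_antisymm h.2 h.1⟩
  · change x i - x j < s at hx
    change y i - y j < s ↔ _
    simp only [hx, hx.not_gt, true_iff, false_iff, not_lt]
    exact ⟨fun h => ⟨h, h.le⟩, fun h => h.1⟩
  · change s < x i - x j at hx
    change s < y i - y j ↔ _
    simp only [hx, hx.not_gt, true_iff, false_iff, not_lt]
    exact ⟨fun h => ⟨h.le, h⟩, fun h => h.2⟩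

/-- The class of a point. -/
def clsSet (m n : ℕ) (x : Fin n → ℝ) : Set (Fin n → ℝ) := {y | SRel m Finset.univ ∅ x y}

lemma inter_eq_cls {m n : ℕ} {σ : Set (Fin n → ℝ) → Set (Fin n → ℝ)}
    (hσ : ∀ H ∈ arrS (SS m) n, IsSideOf n (σ H) H) {x : Fin n → ℝ}
    (hx : x ∈ ⋂ H ∈ arrS (SS m) n, σ H) : ⋂ H ∈ arrS (SS m) n, σ H = clsSet m n x := by
  rw [Set.mem_iInter₂] at hx
  ext y
  rw [Set.mem_iInter₂]
  change _ ↔ SRel m Finset.univ ∅ x y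
  rw [SRel_iff]
  constructor
  · intro h i j hij s hs
    have hH : hyp n i j s ∈ arrS (SS m) n := ⟨i, j, s, hij, hs, rfl⟩
    exact (side_mem hij.ne (hσ _ hH) (hx _ hH) y).1 (h _ hH)
  · rintro h H ⟨i, j, s, hij, hs, rfl⟩
    have hH : hyp n i j s ∈ arrS (SS m) n := ⟨i, j, s, hij, hs, rfl⟩
    exact (side_mem hij.ne (hσ _ hH) (hx _ hH) y).2 (h i j hij s hs)

lemma isFace_iff (m n : ℕ) (F : Set (Fin n → ℝ)) :
    IsFace n (arrS (SS m) n) F ↔ ∃ x, F = clsSet m n x := by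
  constructor
  · rintro ⟨⟨x, hx⟩, σ, hσ, rfl⟩
    exact ⟨x, inter_eq_cls hσ hx⟩
  · rintro ⟨x, rfl⟩
    have : ∀ H : Set (Fin n → ℝ), ∃ σ : Set (Fin n → ℝ), H ∈ arrS (SS m) n →
        (IsSideOf n σ H ∧ x ∈ σ) := by
      intro H
      by_cases hH : H ∈ arrS (SS m) n
      · obtain ⟨i, j, s, hij, hs, rfl⟩ := hH
        rcases lt_trichotomy (x i - x j) s with h | h | h
        · exact ⟨{x | x i - x j < s}, fun _ => ⟨Or.inr ⟨i, j, s, rfl, Or.inl rfl⟩, h⟩⟩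
        · exact ⟨hyp n i j s, fun _ => ⟨Or.inl rfl, h⟩⟩
        · exact ⟨{x | s < x i - x j}, fun _ => ⟨Or.inr ⟨i, j, s, rfl, Or.inr rfl⟩, h⟩⟩
      · exact ⟨∅, fun h => absurd h hH⟩
    choose σ hσ using this
    refine ⟨⟨x, SRel.refl x⟩, σ, fun H hH => (hσ H hH).1, ?_⟩
    symm
    exact inter_eq_cls (fun H hH => (hσ H hH).1) (Set.mem_iInter₂.2 fun H hH => (hσ H hH).2)

lemma exists_eps {m n : ℕ} {x g : Fin n → ℝ} (hg : g ∈ VS m Finset.univ ∅ x) :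
    ∃ ε : ℝ, ε ≠ 0 ∧ x + ε • g ∈ clsSet m n x := by
  have h1 : ∀ᶠ ε : ℝ in nhdsWithin 0 (Set.Ioi 0), ∀ i j : Fin n, ∀ s ∈ Finset.Icc 1 m,
      ((x i < x j + (s : ℝ) ↔ x i + ε * g i < x j + ε * g j + s) ∧
        (x j + (s : ℝ) < x i ↔ x j + ε * g j + s < x i + ε * g i)) := by
    rw [Filter.eventually_all]; intro i
    rw [Filter.eventually_all]; intro j
    rw [Filter.eventually_all_finset]; intro s hs
    obtain ⟨hs1, hs2⟩ := Finset.mem_Icc.1 hs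
    have cl : Filter.Tendsto (fun ε : ℝ => x i + ε * g i) (nhdsWithin 0 (Set.Ioi 0)) (nhds (x i)) := by
      have : Continuous (fun ε : ℝ => x i + ε * g i) := by fun_prop
      have := (this.tendsto 0).mono_left (nhdsWithin_le_nhds (s := Set.Ioi 0))
      simpa using this
    have cr : Filter.Tendsto (fun ε : ℝ => x j + ε * g j + s) (nhdsWithin 0 (Set.Ioi 0))
        (nhds (x j + s)) := by
      have : Continuous (fun ε : ℝ => x j + ε * g j + s) := by fun_prop
      have := (this.tendsto 0).mono_left (nhdsWithin_le_nhds (s := Set.Ioi 0))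
      simpa using this
    rcases lt_trichotomy (x i) (x j + s) with h | h | h
    · filter_upwards [cl.eventually_lt cr h] with ε hε
      simp only [h, hε, h.not_gt, hε.not_gt, and_self]
    · have := hg.2.1 i (Finset.mem_univ _) j (Finset.mem_univ _) s hs1 hs2 h
      refine Filter.Eventually.of_forall fun ε => ?_
      rw [this, h]
      constructor <;> constructor <;> intro h' <;> exfalso <;> linarith
    · filter_upwards [cr.eventually_lt cl h] with ε hε
      simp only [h, hε, h.not_gt, hε.not_gt, and_self]
  obtain ⟨ε, h2, h3⟩ := (h1.and self_mem_nhdsWithin).exists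
  refine ⟨ε, ne_of_gt h3, fun i _ j _ s hs1 hs2 => ?_, fun i _ μ hμ => by simp at hμ⟩
  exact h2 i j s (Finset.mem_Icc.2 ⟨hs1, hs2⟩)

lemma dir_cls (m n : ℕ) (x : Fin n → ℝ) :
    (affineSpan ℝ (clsSet m n x)).direction = VS m Finset.univ ∅ x := by
  rw [direction_affineSpan]
  apply le_antisymm
  · rw [vectorSpan, Submodule.span_le]
    rintro _ ⟨y, hy, z, hz, rfl⟩
    refine ⟨fun i hi => absurd (Finset.mem_univ i) hi, fun i hi j hj s h1 h2 e => ?_,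
      fun i _ h => by simp at h⟩
    have e1 := (SRel.eq_iff hy hi hj h1 h2).1 e
    have e2 := (SRel.eq_iff hz hi hj h1 h2).1 e
    simp only [vsub_eq_sub, Pi.sub_apply]
    linarith
  · intro g hg
    obtain ⟨ε, h0, hε⟩ := exists_eps hg
    have := vsub_mem_vectorSpan ℝ hε (SRel.refl x : x ∈ clsSet m n x)
    rw [vsub_eq_sub, add_sub_cancel_left] at this
    have h2 := Submodule.smul_mem _ ε⁻¹ this
    rwa [smul_smul, inv_mul_cancel₀ h0, one_smul] at h2

/-- Faces are classes. -/
noncomputable def faceEquiv (m n : ℕ) :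
    Quotient (sSet m (Finset.univ : Finset (Fin n)) ∅) ≃
      {F : Set (Fin n → ℝ) // IsFace n (arrS (SS m) n) F} := by
  refine Equiv.ofBijective (fun q => ⟨clsSet m n q.out, (isFace_iff m n _).2 ⟨_, rfl⟩⟩) ⟨?_, ?_⟩
  · intro p q h
    have h' : clsSet m n p.out = clsSet m n q.out := congrArg Subtype.val h
    have : q.out ∈ clsSet m n p.out := by
      rw [h']; exact SRel.refl _
    rw [← Quotient.out_eq p, ← Quotient.out_eq q]
    exact Quotient.sound this
  · rintro ⟨F, hF⟩
    obtain ⟨x, rfl⟩ := (isFace_iff m n F).1 hF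
    refine ⟨Quotient.mk _ x, Subtype.ext ?_⟩
    have hs : SRel m Finset.univ ∅ x (Quotient.mk (sSet m Finset.univ ∅) x).out :=
      (Quotient.exact (Quotient.out_eq (Quotient.mk (sSet m Finset.univ ∅) x))).symm
    ext y
    exact ⟨fun h => hs.trans h, fun h => hs.symm.trans h⟩

lemma faceDim_cls (m n : ℕ) (q : Quotient (sSet m (Finset.univ : Finset (Fin n)) ∅)) :
    faceDim n (faceEquiv m n q).1 = Module.finrank ℝ (VS m Finset.univ ∅ q.out) := by
  change faceDim n (clsSet m n q.out) = _
  rw [faceDim, dir_cls]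

lemma faceCount_eq (m n k : ℕ) : faceCount (SS m) n k =
    Nat.card {q : Quotient (sSet m (Finset.univ : Finset (Fin n)) ∅) //
      Module.finrank ℝ (VS m Finset.univ ∅ q.out) = k} := by
  unfold faceCount
  symm
  refine Nat.card_congr (Equiv.ofBijective
    (fun q => ⟨(faceEquiv m n q.1).1, (faceEquiv m n q.1).2, ?_⟩) ⟨?_, ?_⟩)
  · rw [faceDim_cls]; exact q.2
  · intro p q h
    have h2 : (faceEquiv m n p.1).1 = (faceEquiv m n q.1).1 := by
      have h3 := congrArg Subtype.val h
      exact h3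
    exact Subtype.ext ((faceEquiv m n).injective (Subtype.ext h2))
  · rintro ⟨F, hF, hk⟩
    obtain ⟨q, hq⟩ := (faceEquiv m n).surjective ⟨F, hF⟩
    have hq' : (faceEquiv m n q).1 = F := congrArg Subtype.val hq
    refine ⟨⟨q, ?_⟩, Subtype.ext hq'⟩
    rw [← faceDim_cls, hq', hk]

lemma sum_faceCount (m n : ℕ) :
    ∑ k ∈ Finset.range (n + 1), (faceCount (SS m) n k : ℚ) • (Polynomial.X : Polynomial ℚ) ^ k =
      cnt (sSet m (Finset.univ : Finset (Fin n)) ∅) (wt m Finset.univ ∅) Set.univ := by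
  have := Fintype.ofFinite (Quotient (sSet m (Finset.univ : Finset (Fin n)) ∅))
  unfold cnt
  rw [finsum_eq_sum_of_fintype]
  have h1 : ∀ q : Quotient (sSet m (Finset.univ : Finset (Fin n)) ∅),
      (if q ∈ (Quotient.mk _ '' (Set.univ : Set (Fin n → ℝ))) then
        wt m (Finset.univ : Finset (Fin n)) ∅ q.out else 0) =
      Polynomial.X ^ (Module.finrank ℝ (VS m Finset.univ ∅ q.out)) := by
    intro q
    rw [if_pos ⟨q.out, Set.mem_univ _, Quotient.out_eq q⟩, wt]
  rw [Finset.sum_congr rfl fun q _ => h1 q]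
  rw [← Finset.sum_fiberwise_of_maps_to (s := Finset.univ) (t := Finset.range (n + 1))
    (g := fun q : Quotient (sSet m (Finset.univ : Finset (Fin n)) ∅) =>
      Module.finrank ℝ (VS m Finset.univ ∅ q.out))]
  · refine Finset.sum_congr rfl fun k _ => ?_
    rw [Finset.sum_congr rfl (fun q hq => by rw [(Finset.mem_filter.1 hq).2] :
      ∀ q ∈ Finset.univ.filter (fun q : Quotient (sSet m (Finset.univ : Finset (Fin n)) ∅) =>
        Module.finrank ℝ (VS m Finset.univ ∅ q.out) = k),
        (Polynomial.X : Polynomial ℚ) ^ (Module.finrank ℝ (VS m Finset.univ ∅ q.out)) =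
          Polynomial.X ^ k)]
    rw [Finset.sum_const, faceCount_eq, Nat.card_eq_fintype_card, Fintype.card_subtype,
      Nat.cast_smul_eq_nsmul]
  · intro q _
    have := Submodule.finrank_le (VS m Finset.univ ∅ q.out)
    rw [Module.finrank_fintype_fun_eq_card, Fintype.card_fin] at this
    exact Finset.mem_range.2 (by omega)

lemma cnt_univ (m n : ℕ) :
    cnt (sSet m (Finset.univ : Finset (Fin n)) ∅) (wt m Finset.univ ∅) Set.univ =
      NN m (Finset.univ : Finset (Fin n)) 0 ∅ ∅ := by
  rw [NN_empty]
  rw [cnt_transport (sSet m (Finset.univ : Finset (Fin n)) ∅) (sSet m Finset.univ ∅)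
    (wt m Finset.univ ∅) (wt m Finset.univ ∅)
    (wt_congr (Finset.empty_subset _)) (wt_congr (Finset.empty_subset _)) _
    (Dom Finset.univ 0 ∅) id 1 ?_ ?_ ?_ ?_, one_mul]
  · intro y _
    exact ⟨y, Set.mem_univ _, SRel.refl y⟩
  · intro y _ z _
    exact Iff.rfl
  · intro x _
    refine ⟨fun i => x i + (1 + ∑ j, |x j|), fun i _ => ⟨?_, by simp⟩, ?_⟩
    · have h1 := Finset.single_le_sum (f := fun j => |x j|) (fun j _ => abs_nonneg _)
        (Finset.mem_univ i)
      have h2 := neg_abs_le (x i)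
      linarith
    · refine ⟨fun i _ j _ s _ _ => ?_, fun i _ μ hμ => by simp at hμ⟩
      simp only [id]
      constructor <;> constructor <;> intro h <;> linarith
  · intro y _
    rw [one_mul, id]

lemma FGF_eq (m : ℕ) (H : PowerSeries (Polynomial ℚ)) (hH : H = Phi m H) : FGF (SS m) = H := by
  ext1 n
  rw [FGF, PowerSeries.coeff_mk, sum_faceCount, cnt_univ,
    (NN_formula m H hH n Finset.univ (by simp)).1 0 ∅ (by intro μ hμ; simp at hμ)]
  rw [Finset.card_empty, zero_add, pow_one, Finset.card_univ, Fintype.card_fin, aa, ← mul_assoc,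
    mul_comm (Polynomial.C _), cast_fact_mul, one_mul]

end Face

lemma part_one (m : ℕ) (H : PowerSeries (Polynomial ℚ)) (hH : H = Phi m H) :
    (H - 1 - (1 - EexuNeg) * H ^ (m + 1)) *
      (1 - H - (Eexp - 1) * H + (Eexp - 1) * H ^ (m + 1)) =
      Useries * (Eexp - 1) ^ 2 * (H ^ (m + 2) - H ^ (2 * m + 2)) := by
  have hg : (∑ p ∈ Finset.range m, H ^ p) * (H - 1) = H ^ m - 1 := geom_sum_mul H m
  have e2 : ∑ p ∈ Finset.range m, H ^ (p + 1) = H * ∑ p ∈ Finset.range m, H ^ p := by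
    rw [Finset.mul_sum]
    exact Finset.sum_congr rfl fun p _ => by ring
  have hV := WW_VV m H
  rw [WW, e2] at hV
  have h1 : H - 1 - (1 - EexuNeg) * H ^ (m + 1) = Useries * OmTilde m H := by
    have : H = 1 + (1 - EexuNeg) * H ^ (m + 1) + Useries * OmTilde m H := hH
    linear_combination this
  rw [h1, OmTilde_eq]
  generalize (∑ p ∈ Finset.range m, H ^ p) = G at *
  have h2 : 1 - H - (Eexp - 1) * H + (Eexp - 1) * H ^ (m + 1) =
      (1 - H) * (1 - (Eexp - 1) * (H * G)) := by
    linear_combination (- (Eexp - 1) * H) * hg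
  rw [h2]
  linear_combination (Useries * (Eexp - 1) ^ 2 * H ^ (m + 2) * G * (1 - H)) * hV -
    Useries * (Eexp - 1) ^ 2 * H ^ (m + 2) * hg


/-- Proposition 5.6. The face generating function
`H = F_{[-m;m]∖{0}}(x,u)` of the `m`-extended semiorder arrangements satisfies
`(H - 1 - (1-e^{-xu})H^{m+1})(1 - H - XH + XH^{m+1}) = u X² (H^{m+2} - H^{2m+2})`
with `X = e^x - 1`; equivalently `H = 1 + (1-e^{-xu})H^{m+1} + u·Ω̃(e^x-1, H)`,
and the latter equation characterizes `H`. -/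
theorem semiorder_face_gf (m : ℕ) (hm : 0 < m) :
    (FGF {s : ℤ | s.natAbs ≤ m ∧ s ≠ 0} - 1 -
        (1 - EexuNeg) * (FGF {s : ℤ | s.natAbs ≤ m ∧ s ≠ 0}) ^ (m + 1)) *
      (1 - FGF {s : ℤ | s.natAbs ≤ m ∧ s ≠ 0} -
        (Eexp - 1) * FGF {s : ℤ | s.natAbs ≤ m ∧ s ≠ 0} +
        (Eexp - 1) * (FGF {s : ℤ | s.natAbs ≤ m ∧ s ≠ 0}) ^ (m + 1)) =
      Useries * (Eexp - 1) ^ 2 *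
        ((FGF {s : ℤ | s.natAbs ≤ m ∧ s ≠ 0}) ^ (m + 2) -
          (FGF {s : ℤ | s.natAbs ≤ m ∧ s ≠ 0}) ^ (2 * m + 2)) ∧
    FGF {s : ℤ | s.natAbs ≤ m ∧ s ≠ 0} =
      1 + (1 - EexuNeg) * (FGF {s : ℤ | s.natAbs ≤ m ∧ s ≠ 0}) ^ (m + 1) +
        Useries * OmTilde m (FGF {s : ℤ | s.natAbs ≤ m ∧ s ≠ 0}) ∧
    ∀ H : PowerSeries (Polynomial ℚ),
      H = 1 + (1 - EexuNeg) * H ^ (m + 1) + Useries * OmTilde m H →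
      H = FGF {s : ℤ | s.natAbs ≤ m ∧ s ≠ 0} := by
  change (FGF (SS m) - 1 - (1 - EexuNeg) * (FGF (SS m)) ^ (m + 1)) *
      (1 - FGF (SS m) - (Eexp - 1) * FGF (SS m) + (Eexp - 1) * (FGF (SS m)) ^ (m + 1)) =
      Useries * (Eexp - 1) ^ 2 * ((FGF (SS m)) ^ (m + 2) - (FGF (SS m)) ^ (2 * m + 2)) ∧
    FGF (SS m) = Phi m (FGF (SS m)) ∧
    ∀ H : PowerSeries (Polynomial ℚ), H = Phi m H → H = FGF (SS m)
  obtain ⟨H, hH⟩ := Phi_exists m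
  rw [FGF_eq m H hH]
  exact ⟨part_one m H hH, hH, fun H' h' => Phi_unique m H' H h' hH⟩

end Braid
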